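/- arXiv:1308.6615 — 2 statements merged into one kernel-verified Lean document; each statement's English description precedes it below -/
import Mathlib

section
/- Let X and Y be CAT(0) spaces with Y complete, and f: X → Y a (λ,ε)-quasi-isometry. Then for any D-contracting geodesic ray γ in X based at x₀, the path f∘γ stays bounded distance from a unique geodesic ray β based at f(x₀), and β is D'-contracting where D' depends only on λ, ε, and D. -/
open Set Metric Topology
open scoped ENNReal

/-- A geodesic parameterized by arc length on a subset of `ℝ`. -/
def IsGeodesicOn {X : Type*} [MetricSpace X] (γ : ℝ → X) (I : Set ℝ) : Prop :=
  ∀ ⦃s⦄, s ∈ I → ∀ ⦃t⦄, t ∈ I → dist (γ s) (γ t) = |s - t|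

/-- A geodesic metric space: any two points are joined by a geodesic. -/
class GeodesicSpace (X : Type*) [MetricSpace X] : Prop where
  geodesic : ∀ x y : X, ∃ γ : ℝ → X, γ 0 = x ∧ γ (dist x y) = y ∧
    IsGeodesicOn γ (Set.Icc 0 (dist x y))

/-- A CAT(0) space: a geodesic metric space satisfying the CN (Bruhat–Tits) inequality. -/
class CAT0Space (X : Type*) [MetricSpace X] extends GeodesicSpace X : Prop where
  cn : ∀ x y z m : X, dist y m = dist y z / 2 → dist z m = dist y z / 2 →
    dist x m ^ 2 ≤ (dist x y ^ 2 + dist x z ^ 2) / 2 - dist y z ^ 2 / 4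

/-- A `(K,L)`-quasi-geodesic on a subset of `ℝ`. -/
def IsQuasiGeodesicOn {X : Type*} [MetricSpace X] (K L : ℝ) (γ : ℝ → X) (I : Set ℝ) : Prop :=
  ∀ s ∈ I, ∀ t ∈ I,
    |s - t| / K - L ≤ dist (γ s) (γ t) ∧ dist (γ s) (γ t) ≤ K * |s - t| + L

/-- The set `A` (e.g. the image of a (quasi-)geodesic) is Morse with gauge `M`:
every `(K,L)`-quasi-geodesic with endpoints on `A` stays in the `M K L`-neighborhood of `A`. -/
def IsMorseWith {X : Type*} [MetricSpace X] (M : ℝ → ℝ → ℝ) (A : Set X) : Prop :=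
  ∀ K L : ℝ, 1 ≤ K → 0 ≤ L → ∀ (σ : ℝ → X) (a b : ℝ), a ≤ b →
    IsQuasiGeodesicOn K L σ (Set.Icc a b) → σ a ∈ A → σ b ∈ A →
    ∀ t ∈ Set.Icc a b, Metric.infDist (σ t) A ≤ M K L

/-- `π` is a nearest-point projection onto `A`. -/
def IsProjOn {X : Type*} [MetricSpace X] (π : X → X) (A : Set X) : Prop :=
  ∀ x : X, π x ∈ A ∧ ∀ a ∈ A, dist x (π x) ≤ dist x a

/-- `A` is `D`-contracting with respect to the nearest-point projection `π`. -/
def IsContractingWith {X : Type*} [MetricSpace X] (D : ℝ) (π : X → X) (A : Set X) : Prop :=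
  IsProjOn π A ∧ ∀ x y : X, dist x y < dist x (π x) → dist (π x) (π y) < D

/-- The Hausdorff distance between `A` and `B` is at most `C`. -/
def HausdorffLE {X : Type*} [MetricSpace X] (A B : Set X) (C : ℝ) : Prop :=
  (∀ a ∈ A, ∃ b ∈ B, dist a b ≤ C) ∧ ∀ b ∈ B, ∃ a ∈ A, dist a b ≤ C

/-- A `(lam, eps)`-quasi-isometric embedding. -/
def IsQIEmbedding {X Y : Type*} [MetricSpace X] [MetricSpace Y]
    (lam eps : ℝ) (f : X → Y) : Prop :=
  ∀ s t : X, dist s t / lam - eps ≤ dist (f s) (f t) ∧ dist (f s) (f t) ≤ lam * dist s t + eps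

/-- A `(lam, eps)`-quasi-isometry: a quasi-isometric embedding with `eps`-dense image. -/
def IsQuasiIsometry {X Y : Type*} [MetricSpace X] [MetricSpace Y]
    (lam eps : ℝ) (f : X → Y) : Prop :=
  IsQIEmbedding lam eps f ∧ ∀ y : Y, ∃ x : X, dist (f x) y ≤ eps

/-- Slimness (thin triangle condition (i)) for the set `A` with projection `π`:
for every `x` and every `y ∈ A`, the projection `π x` is within `δ` of the geodesic `[x,y]`. -/
def SlimWith {X : Type*} [MetricSpace X] (δ : ℝ) (π : X → X) (A : Set X) : Prop :=
  ∀ x : X, ∀ y ∈ A, ∀ σ : ℝ → X, σ 0 = x → σ (dist x y) = y →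
    IsGeodesicOn σ (Set.Icc 0 (dist x y)) →
    Metric.infDist (π x) (σ '' Set.Icc 0 (dist x y)) < δ

/-- The lower divergence of `γ` (defined on `I ⊆ ℝ`) at scale `r`: the infimum over `t > r`
of the infimum of lengths of paths from `γ (t-r)` to `γ (t+r)` that avoid the open
`r`-ball about `γ t`. -/
noncomputable def ldiv {X : Type*} [MetricSpace X] (γ : ℝ → X) (I : Set ℝ) (r : ℝ) : ℝ≥0∞ :=
  ⨅ (t : ℝ) (_ : r < t) (_ : Set.Icc (t - r) (t + r) ⊆ I)
    (p : ℝ → X) (a : ℝ) (b : ℝ) (_ : a ≤ b) (_ : p a = γ (t - r)) (_ : p b = γ (t + r))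
    (_ : ∀ s ∈ Set.Icc a b, r ≤ dist (p s) (γ t)),
    eVariationOn p (Set.Icc a b)

/-- The direct limit topology on the union of an increasing family of subspaces. -/
def dirLimTop {R : Type*} [TopologicalSpace R] (S : ℕ → Set R) :
    TopologicalSpace ↥(⋃ n, S n) :=
  ⨆ n, TopologicalSpace.coinduced (Set.inclusion (Set.subset_iUnion S n)) inferInstance

/-! ### Convexity of the metric in CAT(0) spaces -/

theorem cat0_mid_tri {Y : Type*} [MetricSpace Y] [CAT0Space Y] (x y z m n : Y)
    (h1 : dist x m = dist x y / 2) (h2 : dist y m = dist x y / 2)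
    (h3 : dist x n = dist x z / 2) (h4 : dist z n = dist x z / 2) :
    dist m n ≤ dist y z / 2 := by
  have e1 := CAT0Space.cn m x z n h3 h4
  have e2 := CAT0Space.cn z x y m h1 h2
  rw [dist_comm m x, h1, dist_comm m z] at e1
  rw [dist_comm z x, dist_comm z y] at e2
  have h : dist m n ^ 2 ≤ (dist y z / 2) ^ 2 := by nlinarith
  exact le_of_sq_le_sq h (by positivity)
where
  le_of_sq_le_sq {a b : ℝ} (h : a ^ 2 ≤ b ^ 2) (hb : 0 ≤ b) : a ≤ b := abs_le_of_sq_le_sq' h hb |>.2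

theorem cat0_mid_quad {Y : Type*} [MetricSpace Y] [CAT0Space Y] (x y x' y' m m' : Y)
    (h1 : dist x m = dist x y / 2) (h2 : dist y m = dist x y / 2)
    (h3 : dist x' m' = dist x' y' / 2) (h4 : dist y' m' = dist x' y' / 2) :
    dist m m' ≤ (dist x x' + dist y y') / 2 := by
  obtain ⟨σ, s0, s1, hs⟩ := GeodesicSpace.geodesic x y'
  have hd : 0 ≤ dist x y' := dist_nonneg
  set n := σ (dist x y' / 2) with hn
  have n1 : dist x n = dist x y' / 2 := by
    rw [hn]; nth_rewrite 1 [← s0]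
    rw [hs ⟨le_rfl, hd⟩ ⟨by linarith, by linarith⟩, abs_of_nonpos (by linarith)]; ring
  have n2 : dist y' n = dist x y' / 2 := by
    rw [hn]; nth_rewrite 1 [← s1]
    rw [hs ⟨hd, le_rfl⟩ ⟨by linarith, by linarith⟩, abs_of_nonneg (by linarith)]; ring
  have e1 := cat0_mid_tri x y y' m n h1 h2 n1 n2
  have e2 := cat0_mid_tri y' x x' n m' (by rw [n2, dist_comm x y']) (by rw [n1, dist_comm x y'])
    (by rw [h4, dist_comm x' y']) (by rw [h3, dist_comm x' y'])
  have e3 := dist_triangle m n m'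
  linarith [e1, e2, e3]

/-- A bounded function on `[0,1]` satisfying the two half inequalities is nonpositive. -/
theorem nonpos_of_halving (ψ : ℝ → ℝ) (B : ℝ) (hB : ∀ s ∈ Icc (0:ℝ) 1, ψ s ≤ B)
    (h0 : ∀ s ∈ Icc (0:ℝ) (1/2), ψ s ≤ ψ (2 * s) / 2)
    (h1 : ∀ s ∈ Icc (1/2:ℝ) 1, ψ s ≤ ψ (2 * s - 1) / 2) :
    ∀ s ∈ Icc (0:ℝ) 1, ψ s ≤ 0 := by
  have key : ∀ n : ℕ, ∀ s ∈ Icc (0:ℝ) 1, ψ s ≤ B * (1/2) ^ n := by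
    intro n
    induction n with
    | zero => simpa using hB
    | succ n ih =>
      intro s hs
      rw [pow_succ]
      rcases le_total s (1/2) with h | h
      · have := h0 s ⟨hs.1, h⟩
        have := ih (2*s) ⟨by linarith [hs.1], by linarith⟩
        linarith
      · have := h1 s ⟨h, hs.2⟩
        have := ih (2*s-1) ⟨by linarith, by linarith [hs.2]⟩
        linarith
  intro s hs
  have t : Filter.Tendsto (fun n : ℕ => B * (1/2:ℝ)^n) Filter.atTop (𝓝 (B * 0)) :=
    (tendsto_pow_atTop_nhds_zero_of_lt_one (by norm_num) (by norm_num)).const_mul B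
  rw [mul_zero] at t
  exact ge_of_tendsto' t (fun n => key n s hs)

theorem cat0_convex {Y : Type*} [MetricSpace Y] [CAT0Space Y] (σ τ : ℝ → Y) (L L' : ℝ)
    (hL : 0 ≤ L) (hL' : 0 ≤ L') (hσ : IsGeodesicOn σ (Icc 0 L)) (hτ : IsGeodesicOn τ (Icc 0 L'))
    (s : ℝ) (hs : s ∈ Icc (0:ℝ) 1) :
    dist (σ (s * L)) (τ (s * L')) ≤ (1 - s) * dist (σ 0) (τ 0) + s * dist (σ L) (τ L') := by
  have memL : ∀ (M : ℝ), 0 ≤ M → ∀ u ∈ Icc (0:ℝ) 1, u * M ∈ Icc 0 M := by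
    intro M hM u hu
    exact ⟨mul_nonneg hu.1 hM, by nlinarith [hu.2]⟩
  have mid : ∀ u ∈ Icc (0:ℝ) 1, ∀ v ∈ Icc (0:ℝ) 1,
      dist (σ ((u+v)/2 * L)) (τ ((u+v)/2 * L')) ≤
        (dist (σ (u*L)) (τ (u*L')) + dist (σ (v*L)) (τ (v*L'))) / 2 := by
    intro u hu v hv
    have hm : (u+v)/2 ∈ Icc (0:ℝ) 1 := ⟨by linarith [hu.1, hv.1], by linarith [hu.2, hv.2]⟩
    have g : ∀ (ρ : ℝ → Y) (M : ℝ), 0 ≤ M → IsGeodesicOn ρ (Icc 0 M) →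
        dist (ρ (u*M)) (ρ ((u+v)/2*M)) = dist (ρ (u*M)) (ρ (v*M)) / 2 ∧
        dist (ρ (v*M)) (ρ ((u+v)/2*M)) = dist (ρ (u*M)) (ρ (v*M)) / 2 := by
      intro ρ M hM hρ
      rw [hρ (memL M hM u hu) (memL M hM _ hm), hρ (memL M hM v hv) (memL M hM _ hm),
        hρ (memL M hM u hu) (memL M hM v hv)]
      constructor
      · rw [show u*M - (u+v)/2*M = (u*M - v*M)/2 by ring, abs_div, abs_two]
      · rw [show v*M - (u+v)/2*M = -((u*M - v*M)/2) by ring, abs_neg, abs_div, abs_two]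
    exact cat0_mid_quad _ _ _ _ _ _ (g σ L hL hσ).1 (g σ L hL hσ).2 (g τ L' hL' hτ).1
      (g τ L' hL' hτ).2
  set ψ : ℝ → ℝ := fun s => dist (σ (s * L)) (τ (s * L')) -
    ((1 - s) * dist (σ 0) (τ 0) + s * dist (σ L) (τ L')) with hψ
  have p0 : (0:ℝ) ∈ Icc (0:ℝ) 1 := by simp
  have p1 : (1:ℝ) ∈ Icc (0:ℝ) 1 := by simp
  have := nonpos_of_halving ψ (L + dist (σ 0) (τ 0) + L') ?_ ?_ ?_ s hs
  · simp only [hψ] at this; linarith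
  · intro u hu
    have a1 : dist (σ (u*L)) (σ 0) ≤ L := by
      rw [hσ (memL L hL u hu) ⟨le_rfl, hL⟩, sub_zero, abs_of_nonneg (memL L hL u hu).1]
      exact (memL L hL u hu).2
    have a2 : dist (τ 0) (τ (u*L')) ≤ L' := by
      rw [hτ ⟨le_rfl, hL'⟩ (memL L' hL' u hu), zero_sub, abs_neg,
        abs_of_nonneg (memL L' hL' u hu).1]
      exact (memL L' hL' u hu).2
    have a3 := dist_triangle4 (σ (u*L)) (σ 0) (τ 0) (τ (u*L'))
    have a4 : 0 ≤ (1 - u) * dist (σ 0) (τ 0) + u * dist (σ L) (τ L') :=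
      add_nonneg (mul_nonneg (by linarith [hu.2]) dist_nonneg) (mul_nonneg hu.1 dist_nonneg)
    simp only [hψ]; linarith
  · intro u hu
    have := mid 0 p0 (2*u) ⟨by linarith [hu.1], by linarith [hu.2]⟩
    rw [show (0 + 2*u)/2 = u by ring, zero_mul, zero_mul] at this
    simp only [hψ]; linarith
  · intro u hu
    have := mid 1 p1 (2*u-1) ⟨by linarith [hu.1], by linarith [hu.2]⟩
    rw [show (1 + (2*u-1))/2 = u by ring, one_mul, one_mul] at this
    simp only [hψ]; linarith

/-- Geodesics issuing from a common point. -/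
theorem cat0_fan {Y : Type*} [MetricSpace Y] [CAT0Space Y] (σ τ : ℝ → Y) (L : ℝ)
    (hL : 0 < L) (hσ : IsGeodesicOn σ (Icc 0 L)) (hτ : IsGeodesicOn τ (Icc 0 L))
    (h0 : σ 0 = τ 0) (t : ℝ) (ht : t ∈ Icc 0 L) :
    dist (σ t) (τ t) ≤ t / L * dist (σ L) (τ L) := by
  have := cat0_convex σ τ L L hL.le hL.le hσ hτ (t / L)
    ⟨div_nonneg ht.1 hL.le, by rw [div_le_one hL]; exact ht.2⟩
  rw [div_mul_cancel₀ _ hL.ne', h0, dist_self] at this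
  linarith

/-! ### Coarse tools -/

theorem last_exit (P : ℝ → Prop) (a t : ℝ) (hat : a ≤ t) (ha : P a) :
    ∃ s ∈ Icc a t, P s ∧ ∀ u ∈ Icc (s + 1) t, ¬ P u := by
  set S : Set ℝ := {s | s ∈ Icc a t ∧ P s} with hS
  have ne : S.Nonempty := ⟨a, ⟨le_rfl, hat⟩, ha⟩
  have bd : BddAbove S := ⟨t, fun s hs => hs.1.2⟩
  obtain ⟨s, hs, hs'⟩ := exists_lt_of_lt_csSup ne (show sSup S - 1 < sSup S by linarith)
  refine ⟨s, hs.1, hs.2, fun u hu hPu => ?_⟩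
  have : u ≤ sSup S := le_csSup bd ⟨⟨by linarith [hu.1, hs.1.1], hu.2⟩, hPu⟩
  linarith [hu.1]

theorem first_entry (P : ℝ → Prop) (t b : ℝ) (htb : t ≤ b) (hb : P b) :
    ∃ s ∈ Icc t b, P s ∧ ∀ u ∈ Icc t (s - 1), ¬ P u := by
  obtain ⟨s, hs, hP, h⟩ := last_exit (fun s => P (-s)) (-b) (-t) (by linarith) (by simpa using hb)
  refine ⟨-s, ⟨by linarith [hs.2], by linarith [hs.1]⟩, hP, fun u hu => ?_⟩
  have := h (-u) ⟨by linarith [hu.2], by linarith [hu.1]⟩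
  simpa using this

theorem step_lemma {Y : Type*} [MetricSpace Y] (F : ℝ → Y) (δ C : ℝ) (hδ : 0 < δ) (hC : 0 ≤ C)
    (u v : ℝ) (huv : u ≤ v)
    (h : ∀ s ∈ Icc u v, ∀ s' ∈ Icc u v, |s - s'| ≤ δ → dist (F s) (F s') ≤ C) :
    dist (F u) (F v) ≤ C * ((v - u) / δ + 1) := by
  have key : ∀ n : ℕ, ∀ w ∈ Icc u v, w - u ≤ n * δ → dist (F u) (F w) ≤ n * C := by
    intro n
    induction n with
    | zero =>
      intro w hw hn
      have : w = u := le_antisymm (by simp at hn; linarith) hw.1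
      simp [this]
    | succ n ih =>
      intro w hw hn
      push_cast at hn ⊢
      have hm : max u (w - δ) ∈ Icc u v := ⟨le_max_left _ _, max_le huv (by linarith [hw.2])⟩
      have e1 := ih (max u (w - δ)) hm (by
        rw [sub_le_iff_le_add]
        exact max_le (by nlinarith [hδ.le, (Nat.cast_nonneg n : (0:ℝ) ≤ n)]) (by linarith))
      have e2 := h (max u (w-δ)) hm w hw (by
        rw [abs_sub_comm, abs_of_nonneg]
        · linarith [le_max_right u (w-δ)]
        · linarith [max_le hw.1 (by linarith : w - δ ≤ w)])
      linarith [dist_triangle (F u) (F (max u (w-δ))) (F w)]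
  have hq : 0 ≤ (v-u)/δ := div_nonneg (by linarith) hδ.le
  have e := key ⌈(v-u)/δ⌉₊ v ⟨huv, le_rfl⟩ (by
    rw [← div_le_iff₀ hδ]; exact Nat.le_ceil _)
  have e2 : (⌈(v-u)/δ⌉₊ : ℝ) ≤ (v-u)/δ + 1 := (Nat.ceil_lt_add_one hq).le
  nlinarith
/-! ### Coarse contracting data -/

/-- Coarse contracting map `q` onto (a neighbourhood of) `A` with constant `Λ`. -/
structure QC {Y : Type*} [MetricSpace Y] (Λ : ℝ) (A : Set Y) (q : Y → Y) : Prop where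
  one_le : 1 ≤ Λ
  near : ∀ y, ∃ a ∈ A, dist (q y) a ≤ Λ
  height : ∀ y, ∀ a ∈ A, dist y (q y) ≤ Λ * dist y a + Λ
  lip : ∀ y z, dist (q y) (q z) ≤ Λ * dist y z + Λ
  contr : ∀ y z, Λ * (dist y z + 1) ≤ dist y (q y) → dist (q y) (q z) ≤ Λ

/-- `a` is a nearest point of `A` to `y`. -/
def NP {Y : Type*} [MetricSpace Y] (A : Set Y) (y a : Y) : Prop :=
  a ∈ A ∧ ∀ b ∈ A, dist y a ≤ dist y b

theorem NP.segment {Y : Type*} [MetricSpace Y] {A : Set Y} {y a : Y} (h : NP A y a) (σ : ℝ → Y)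
    (h0 : σ 0 = a) (h1 : σ (dist y a) = y) (hσ : IsGeodesicOn σ (Icc 0 (dist y a)))
    (t : ℝ) (ht : t ∈ Icc 0 (dist y a)) : NP A (σ t) a ∧ dist (σ t) a = t := by
  have e : dist (σ t) a = t := by
    rw [← h0, hσ ht ⟨le_rfl, dist_nonneg⟩, sub_zero, abs_of_nonneg ht.1]
  refine ⟨⟨h.1, fun b hb => ?_⟩, e⟩
  have e2 : dist y (σ t) = dist y a - t := by
    nth_rewrite 1 [← h1]
    rw [hσ ⟨dist_nonneg, le_rfl⟩ ht, abs_of_nonneg (by linarith [ht.2])]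
  have := h.2 b hb
  have := dist_triangle y (σ t) b
  linarith

theorem exists_geod {Y : Type*} [MetricSpace Y] [GeodesicSpace Y] (y a : Y) :
    ∃ σ : ℝ → Y, σ 0 = a ∧ σ (dist y a) = y ∧ IsGeodesicOn σ (Icc 0 (dist y a)) := by
  rw [dist_comm]; exact GeodesicSpace.geodesic a y

universe uu

/-- Step 1: the nearest point projection and `q` agree up to a sublinear error. -/
theorem sublin (Λ : ℝ) (hΛ : 1 ≤ Λ) (η : ℝ) (hη : 0 < η) (hη1 : η ≤ 1) : ∃ K : ℝ, 0 ≤ K ∧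
    ∀ (Y : Type uu) [MetricSpace Y] [GeodesicSpace Y] (A : Set Y) (q : Y → Y), QC Λ A q →
      ∀ y a, NP A y a → dist (q y) a ≤ (Λ + 1) * η * dist y a + K := by
  refine ⟨(Λ + 1) * (4 * Λ / η) + 2 * Λ + Λ * (2 * Λ / η), by positivity, ?_⟩
  intro Y _ _ A q hq y a hya
  have hH : 0 ≤ dist y a := dist_nonneg
  have hqy := hq.height y a hya.1
  have pos1 : 0 ≤ Λ * (2 * Λ / η) := by positivity
  have pos2 : 0 ≤ (Λ+1) * (4 * Λ / η) := by positivity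
  have pos3 : 0 ≤ (Λ+1) * η * dist y a := by positivity
  rcases lt_or_ge (η * dist y a) (4 * Λ) with hlt | hge
  · have h1 : dist y a ≤ 4 * Λ / η := by rw [le_div_iff₀ hη]; linarith
    have h2 := dist_triangle (q y) y a
    rw [dist_comm (q y) y] at h2
    have h3 : (Λ+1) * dist y a ≤ (Λ+1) * (4*Λ/η) := by gcongr
    linarith
  · have hHpos : 0 < dist y a := by
      by_contra hcon
      have : dist y a = 0 := le_antisymm (not_lt.1 hcon) hH
      rw [this] at hge; linarith
    obtain ⟨σ, s0, s1, hs⟩ := exists_geod y a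
    set H := dist y a with hHdef
    set w := σ (η * H) with hw
    have hmem : η * H ∈ Icc 0 H := ⟨by positivity, by nlinarith⟩
    have hst := step_lemma (fun s => q (σ s)) (η * H / (2 * Λ)) Λ (by positivity) (by linarith)
      (η * H) H hmem.2 (by
        intro s hs1 s' hs1' hss
        apply hq.contr
        have m1 : s ∈ Icc 0 H := ⟨by linarith [hs1.1, hmem.1], hs1.2⟩
        have m2 : s' ∈ Icc 0 H := ⟨by linarith [hs1'.1, hmem.1], hs1'.2⟩
        rw [hs m1 m2]
        obtain ⟨n1, n2⟩ := hya.segment σ s0 s1 hs s m1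
        obtain ⟨b, hb, hb'⟩ := hq.near (σ s)
        have n3 := n1.2 b hb
        have n4 := dist_triangle (σ s) (q (σ s)) b
        have n5 : Λ * |s - s'| ≤ Λ * (η * H / (2 * Λ)) := by gcongr
        have n6 : Λ * (η * H / (2 * Λ)) = η * H / 2 := by field_simp
        linarith [hs1.1])
    simp only [s1] at hst
    have c1 : Λ * ((H - η * H) / (η * H / (2 * Λ)) + 1) ≤ Λ * (2 * Λ / η) + Λ := by
      have : (H - η * H) / (η * H / (2 * Λ)) ≤ 2 * Λ / η := by
        rw [div_le_iff₀ (by positivity)]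
        have : 2 * Λ / η * (η * H / (2 * Λ)) = H := by field_simp
        rw [this]; linarith [hmem.1]
      have : Λ * ((H - η * H) / (η * H / (2 * Λ))) ≤ Λ * (2 * Λ / η) := by gcongr
      linarith
    obtain ⟨n1, n2⟩ := hya.segment σ s0 s1 hs (η * H) hmem
    have c2 := hq.height w a hya.1
    rw [← hw] at n2
    have c3 := dist_triangle4 (q y) (q w) w a
    rw [dist_comm (q y) (q w), dist_comm (q w) w] at c3
    rw [← hw] at hst
    rw [n2] at c2 c3
    linarith

/-- Step 2: nearest point projections are sublinearly contracting. -/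
theorem sublin_contr (Λ : ℝ) (hΛ : 1 ≤ Λ) (η : ℝ) (hη : 0 < η) : ∃ K : ℝ, 0 ≤ K ∧
    ∀ (Y : Type uu) [MetricSpace Y] [GeodesicSpace Y] (A : Set Y) (q : Y → Y), QC Λ A q →
      ∀ x y a b, NP A x a → NP A y b → dist x y ≤ dist x a / (2 * Λ) →
        dist a b ≤ η * dist x a + K := by
  obtain ⟨K, hK, h⟩ := sublin.{uu} Λ hΛ (min 1 (η / (3 * (Λ + 1)))) (by positivity) (min_le_left _ _)
  refine ⟨16 * Λ + 2 * K, by positivity, ?_⟩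
  intro Y _ _ A q hq x y a b hx hy hxy
  have hH : 0 ≤ dist x a := dist_nonneg
  have hxy' : dist x y ≤ dist x a := hxy.trans (div_le_self hH (by linarith))
  have hyb : dist y b ≤ 2 * dist x a := by
    have := hy.2 a hx.1
    have := dist_triangle_left y a x
    linarith
  have hη0 : 0 ≤ η * dist x a := by positivity
  rcases lt_or_ge (dist x a) (4 * Λ) with hlt | hge
  · have := dist_triangle4 a x y b
    rw [dist_comm a x] at this
    linarith
  · have hc : dist (q x) (q y) ≤ Λ := by
      apply hq.contr
      obtain ⟨c, hc, hc'⟩ := hq.near x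
      have n3 := hx.2 c hc
      have n4 := dist_triangle x (q x) c
      have : Λ * dist x y ≤ Λ * (dist x a / (2 * Λ)) := by gcongr
      have : Λ * (dist x a / (2 * Λ)) = dist x a / 2 := by field_simp
      linarith
    have e1 := h Y A q hq x a hx
    have e2 := h Y A q hq y b hy
    set θ := min 1 (η / (3 * (Λ + 1)))
    have hθ0 : 0 ≤ θ := by positivity
    have hθ : (Λ + 1) * θ ≤ η / 3 := by
      have : (Λ + 1) * θ ≤ (Λ + 1) * (η / (3 * (Λ + 1))) := by
        gcongr; exact min_le_right _ _
      have e : (Λ + 1) * (η / (3 * (Λ + 1))) = η / 3 := by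
        have : Λ + 1 ≠ 0 := by positivity
        field_simp
      linarith
    have e3 : (Λ + 1) * θ * dist x a ≤ η / 3 * dist x a := by gcongr
    have e4 : (Λ + 1) * θ * dist y b ≤ η / 3 * (2 * dist x a) := by gcongr
    have := dist_triangle4 a (q x) (q y) b
    rw [dist_comm a (q x)] at this
    linarith

/-- Step 3: contraction at a small scale, using convexity. -/
theorem small_contr (Λ : ℝ) (hΛ : 1 ≤ Λ) : ∃ C : ℝ, 0 ≤ C ∧
    ∀ (Y : Type uu) [MetricSpace Y] [CAT0Space Y] (A : Set Y) (q : Y → Y), QC Λ A q →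
      ∀ x y a b, NP A x a → NP A y b → 4 * Λ * dist x y ≤ dist x a → dist a b ≤ C := by
  obtain ⟨K, hK, h⟩ := sublin_contr.{uu} Λ hΛ (1 / (8 * Λ)) (by positivity)
  refine ⟨2 * K, by positivity, ?_⟩
  intro Y _ _ A q hq x y a b hx hy hxy
  set H := dist x a with hHdef
  set H' := dist y b with hHdef'
  set l := dist a b with hl
  have hl0 : 0 ≤ l := dist_nonneg
  have hH0 : 0 ≤ H := dist_nonneg
  have hH0' : 0 ≤ H' := dist_nonneg
  have hd0 : 0 ≤ dist x y := dist_nonneg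
  have e0 := h Y A q hq x y a b hx hy (by rw [le_div_iff₀ (by positivity)]; nlinarith)
  rw [← hl, ← hHdef] at e0
  rcases lt_or_ge H (4 * Λ * l) with hlt | hge
  · have : 1 / (8 * Λ) * H ≤ 1 / (8 * Λ) * (4 * Λ * l) := by gcongr
    have e : 1 / (8 * Λ) * (4 * Λ * l) = l / 2 := by field_simp; linarith
    linarith
  · rcases hH0.eq_or_lt with hz | hpos
    · rw [← hz] at e0; linarith
    set s := 4 * Λ * l / H with hs
    have hs1 : s ∈ Icc (0:ℝ) 1 := ⟨by positivity, by rw [hs, div_le_one hpos]; exact hge⟩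
    have hsH : s * H = 4 * Λ * l := by rw [hs]; field_simp
    obtain ⟨σ, s0, s1, hσ⟩ := exists_geod x a
    obtain ⟨τ, t0, t1, hτ⟩ := exists_geod y b
    have m1 : s * H ∈ Icc 0 H := ⟨by nlinarith [hs1.1], by nlinarith [hs1.2]⟩
    have m2 : s * H' ∈ Icc 0 H' := ⟨by nlinarith [hs1.1], by nlinarith [hs1.2]⟩
    obtain ⟨n1, n1'⟩ := hx.segment σ s0 s1 hσ _ m1
    obtain ⟨n2, n2'⟩ := hy.segment τ t0 t1 hτ _ m2
    have cv := cat0_convex σ τ H H' hH0 hH0' hσ hτ s hs1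
    rw [s0, t0, s1, t1, ← hl] at cv
    have c1 : (1 - s) * l ≤ l := by nlinarith [hs1.1]
    have c2 : s * dist x y ≤ l := by
      have : s * (4 * Λ * dist x y) ≤ s * H := mul_le_mul_of_nonneg_left hxy hs1.1
      rw [hsH] at this
      have : 4 * Λ * (s * dist x y) ≤ 4 * Λ * l := by linarith
      exact le_of_mul_le_mul_left this (by positivity)
    have e1 := h Y A q hq _ _ a b n1 n2 (by
      have : dist (σ (s * H)) (τ (s * H')) ≤ 2 * l := by linarith
      rw [n1', le_div_iff₀ (by positivity)]
      nlinarith)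
    rw [n1', hsH, ← hl] at e1
    have e : 1 / (8 * Λ) * (4 * Λ * l) = l / 2 := by field_simp; linarith
    linarith

/-- Step 5: the projection moves a bounded amount along a geodesic above its final height. -/
theorem above_contr (Λ : ℝ) (hΛ : 1 ≤ Λ) : ∃ R C : ℝ, 1 ≤ R ∧ 0 ≤ C ∧
    ∀ (Y : Type uu) [MetricSpace Y] [CAT0Space Y] (A : Set Y) (q : Y → Y), QC Λ A q →
      ∀ p : Y → Y, IsProjOn p A → ∀ (σ : ℝ → Y) (L : ℝ), 0 ≤ L → IsGeodesicOn σ (Icc 0 L) →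
      R ≤ dist (σ L) (p (σ L)) →
      (∀ s ∈ Icc 0 L, dist (σ L) (p (σ L)) ≤ dist (σ s) (p (σ s))) →
      dist (p (σ 0)) (p (σ L)) ≤ C := by
  obtain ⟨C, hC, h⟩ := small_contr.{uu} Λ hΛ
  set k := 4 * Λ with hk
  have hk4 : 4 ≤ k := by linarith
  refine ⟨2 * C * (k * (k + 1)) + 1, 2 * (2 * C + C * (k * (k + 1))), ?_, by positivity, ?_⟩
  · have : 0 ≤ 2 * C * (k * (k + 1)) := by positivity
    linarith
  intro Y _ _ A q hq p hp σ L hL hσ hR habove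
  have np : ∀ y, NP A y (p y) := hp
  set R' := dist (σ L) (p (σ L)) with hR'
  set l := dist (p (σ 0)) (p (σ L)) with hl
  set H := dist (σ 0) (p (σ 0)) with hH
  have hl0 : 0 ≤ l := dist_nonneg
  have hH0 : 0 ≤ H := dist_nonneg
  have hCk : 0 ≤ 2 * C * (k * (k + 1)) := by positivity
  have hR0 : 0 < R' := by linarith
  set W := l + R' with hW
  have hW0 : 0 < W := by linarith
  have hae : dist (p (σ 0)) (σ L) ≤ W := by
    have := dist_triangle (p (σ 0)) (p (σ L)) (σ L)
    rw [dist_comm (p (σ L)) (σ L)] at this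
    linarith
  have hLd : dist (σ 0) (σ L) = L := by
    rw [hσ ⟨le_rfl, hL⟩ ⟨hL, le_rfl⟩, zero_sub, abs_neg, abs_of_nonneg hL]
  have hLW : L ≤ H + W := by
    have := dist_triangle (σ 0) (p (σ 0)) (σ L)
    linarith
  have steps : ∀ u ∈ Icc 0 L, L - u ≤ (k + 1) * W →
      dist (p (σ u)) (p (σ L)) ≤ C * ((k + 1) * W * k / R' + 1) := by
    intro u hu hw
    have := step_lemma (fun s => p (σ s)) (R' / k) C (by positivity) hC u L hu.2 (by
      intro s hs s' hs' hss
      have m1 : s ∈ Icc 0 L := ⟨by linarith [hs.1, hu.1], hs.2⟩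
      have m2 : s' ∈ Icc 0 L := ⟨by linarith [hs'.1, hu.1], hs'.2⟩
      apply h Y A q hq (σ s) (σ s') _ _ (np _) (np _)
      rw [hσ m1 m2]
      have : k * |s - s'| ≤ k * (R' / k) := by gcongr
      have e : k * (R' / k) = R' := by field_simp
      linarith [habove s m1])
    refine this.trans ?_
    have e : (L - u) / (R' / k) ≤ (k + 1) * W * k / R' := by
      rw [div_div_eq_mul_div]; gcongr
    gcongr
  have main : l ≤ C + C * ((k + 1) * W * k / R' + 1) := by
    rcases le_or_gt H (k * W) with hle | hgt
    · have := steps 0 ⟨le_rfl, hL⟩ (by linarith)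
      linarith
    · have hHpos : 0 < H := by
        have : 0 < k * W := by positivity
        linarith
      set s := k * W / H with hs
      have hs1 : s ∈ Icc (0:ℝ) 1 := ⟨by positivity, by rw [hs, div_le_one hHpos]; exact hgt.le⟩
      have hsH : s * H = k * W := by rw [hs]; field_simp
      obtain ⟨τ, t0, t1, hτ⟩ := exists_geod (σ 0) (p (σ 0))
      have hrev : IsGeodesicOn (fun t => σ (L - t)) (Icc 0 L) := by
        intro u hu v hv
        simp only
        rw [hσ ⟨by linarith [hu.2], by linarith [hu.1]⟩ ⟨by linarith [hv.2], by linarith [hv.1]⟩,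
          show L - u - (L - v) = -(u - v) by ring, abs_neg]
      have cv := cat0_convex τ (fun t => σ (L - t)) H L hH0 hL hτ hrev s hs1
      simp only [sub_zero, sub_self] at cv
      rw [t0, t1, dist_self, mul_zero, add_zero] at cv
      have m1 : s * H ∈ Icc 0 H := ⟨by nlinarith [hs1.1], by nlinarith [hs1.2]⟩
      have m2 : L - s * L ∈ Icc 0 L := ⟨by nlinarith [hs1.2], by nlinarith [hs1.1]⟩
      obtain ⟨n1, n1'⟩ := (np (σ 0)).segment τ t0 t1 hτ _ m1
      have c1 : (1 - s) * dist (p (σ 0)) (σ L) ≤ W := by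
        have : 0 ≤ dist (p (σ 0)) (σ L) := dist_nonneg
        nlinarith [hs1.1]
      have e1 := h Y A q hq _ (σ (L - s * L)) _ _ n1 (np _) (by
        have := cv.trans c1
        rw [n1']
        nlinarith)
      have e2 := steps (L - s * L) m2 (by
        have : s * L ≤ s * (H + W) := mul_le_mul_of_nonneg_left hLW hs1.1
        nlinarith [hs1.2])
      linarith [dist_triangle (p (σ 0)) (p (σ (L - s * L))) (p (σ L))]
  have e : (k + 1) * W * k / R' = (k * (k+1)) * l / R' + k * (k + 1) := by
    rw [hW]; field_simp
  rw [e] at main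
  have e2 : C * ((k * (k+1)) * l / R') ≤ l / 2 := by
    rw [← mul_div_assoc, div_le_iff₀ hR0]
    nlinarith
  linarith

/-- Step 6: coarse contracting data on a set with nearest points gives a contracting set. -/
theorem full_contr (Λ : ℝ) (hΛ : 1 ≤ Λ) : ∃ D' : ℝ,
    ∀ (Y : Type uu) [MetricSpace Y] [CAT0Space Y] (A : Set Y) (q : Y → Y), QC Λ A q →
      ∀ p : Y → Y, IsProjOn p A → IsContractingWith D' p A := by
  obtain ⟨R, C, hR, hC, h⟩ := above_contr.{uu} Λ hΛ
  refine ⟨4 * (C + R) + 2 * C + 1, ?_⟩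
  intro Y _ _ A q hq p hp
  refine ⟨hp, fun x y hxy => ?_⟩
  have hpx := (hp x).2
  have hpy := (hp y).2
  obtain ⟨σ, s0, s1, hσ⟩ := GeodesicSpace.geodesic x y
  set L := dist x y with hLdef
  have hL : 0 ≤ L := dist_nonneg
  set Ht : ℝ → ℝ := fun s => dist (σ s) (p (σ s)) with hHt
  have lip1 : ∀ y z : Y, dist y (p y) ≤ dist y z + dist z (p z) := fun y z =>
    ((hp y).2 _ (hp z).1).trans (dist_triangle _ _ _)
  have cont : ContinuousOn Ht (Icc 0 L) := by
    have : LipschitzOnWith 1 Ht (Icc 0 L) := by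
      apply LipschitzOnWith.of_dist_le_mul
      intro s hs t ht
      rw [NNReal.coe_one, one_mul, Real.dist_eq, Real.dist_eq, ← hσ hs ht, abs_le]
      have a1 := lip1 (σ s) (σ t)
      have a2 := lip1 (σ t) (σ s)
      rw [dist_comm (σ t) (σ s)] at a2
      simp only [hHt]
      constructor <;> linarith
    exact this.continuousOn
  obtain ⟨m, hm, hmin⟩ := isCompact_Icc.exists_isMinOn ⟨0, ⟨le_rfl, hL⟩⟩ cont
  have hmin' : ∀ s ∈ Icc 0 L, Ht m ≤ Ht s := fun s hs => hmin hs
  rcases le_or_gt R (Ht m) with hge | hlt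
  · have e1 := h Y A q hq p hp σ m hm.1
      (fun u hu v hv => hσ ⟨hu.1, hu.2.trans hm.2⟩ ⟨hv.1, hv.2.trans hm.2⟩) hge
      (fun s hs => hmin' s ⟨hs.1, hs.2.trans hm.2⟩)
    have e2 := h Y A q hq p hp (fun t => σ (L - t)) (L - m) (by linarith [hm.2])
      (fun u hu v hv => by
        simp only
        rw [hσ ⟨by linarith [hu.2, hm.1], by linarith [hu.1]⟩
          ⟨by linarith [hv.2, hm.1], by linarith [hv.1]⟩,
          show L - u - (L - v) = -(u - v) by ring, abs_neg])
      (by simpa using hge)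
      (fun s hs => by
        simpa using hmin' (L - s) ⟨by linarith [hs.2, hm.1], by linarith [hs.1]⟩)
    simp only [sub_zero, sub_sub_cancel] at e2
    rw [s0] at e1
    rw [s1] at e2
    have := dist_triangle_right (p x) (p y) (p (σ m))
    linarith
  · rcases le_or_gt (dist x (p x)) R with hxs | hxl
    · have a1 := dist_triangle4 (p x) x y (p y)
      rw [dist_comm (p x) x] at a1
      have a2 := lip1 y x
      rw [dist_comm y x] at a2
      linarith
    · set S : Set ℝ := {s | s ∈ Icc 0 L ∧ Ht s ≤ R} with hS
      have hcl : IsCompact S := by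
        have : IsClosed S := cont.preimage_isClosed_of_isClosed isClosed_Icc isClosed_Iic
        exact isCompact_Icc.of_isClosed_subset this (fun s hs => hs.1)
      obtain ⟨t, htS, htl⟩ := hcl.exists_isLeast ⟨m, hm, hlt.le⟩
      have hbefore : ∀ s ∈ Icc 0 t, R ≤ Ht s := by
        intro s hs
        by_contra hcon
        push Not at hcon
        have hsL : s ≤ L := hs.2.trans htS.1.2
        have hst : t ≤ s := htl ⟨⟨hs.1, hsL⟩, hcon.le⟩
        have : s = t := le_antisymm hs.2 hst
        subst this
        have iv := intermediate_value_Icc' hs.1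
          (cont.mono (Icc_subset_Icc_right hsL))
        obtain ⟨r, hr, hrR⟩ := iv ⟨hcon.le, by simp only [hHt, s0]; exact hxl.le⟩
        have : s ≤ r := htl ⟨⟨hr.1, hr.2.trans hsL⟩, hrR.le⟩
        have : r = s := le_antisymm hr.2 this
        subst this
        linarith
      have hHtt : Ht t = R := le_antisymm htS.2 (hbefore t ⟨htS.1.1, le_rfl⟩)
      have e1 := h Y A q hq p hp σ t htS.1.1
        (fun u hu v hv => hσ ⟨hu.1, hu.2.trans htS.1.2⟩ ⟨hv.1, hv.2.trans htS.1.2⟩) hHtt.ge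
        (fun s hs => by
          have := hbefore s hs
          simp only [hHt] at hHtt this
          linarith)
      rw [s0] at e1
      simp only [hHt] at hHtt
      have d1 : dist x (σ t) = t := by
        rw [← s0, hσ ⟨le_rfl, hL⟩ htS.1, zero_sub, abs_neg, abs_of_nonneg htS.1.1]
      have d2 : dist (σ t) y = L - t := by
        rw [← s1]
        rw [hσ htS.1 ⟨hL, le_rfl⟩, abs_sub_comm, abs_of_nonneg (by linarith [htS.1.2])]
      have d3 : dist (p x) (σ t) ≤ C + R := by
        have := dist_triangle_right (p x) (σ t) (p (σ t))
        linarith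
      have d4 := dist_triangle x (σ t) (p x)
      rw [dist_comm (σ t) (p x)] at d4
      have d5 := hpy (p x) (hp x).1
      have d6 := dist_triangle y (σ t) (p x)
      rw [dist_comm y (σ t), dist_comm (σ t) (p x)] at d6
      have d7 := dist_triangle4 (p x) (σ t) y (p y)
      linarith
/-! ### Stability of geodesics and construction of the limit ray -/

theorem QC.h_lip {Y : Type*} [MetricSpace Y] {Λ : ℝ} {A : Set Y} {q : Y → Y} (hq : QC Λ A q)
    (y z : Y) : dist y (q y) ≤ dist z (q z) + (1 + Λ) * dist y z + Λ := by
  have h1 := dist_triangle4 y z (q z) (q y)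
  have h2 := hq.lip z y
  rw [dist_comm z y] at h2
  linarith

theorem morse_lemma (Λ : ℝ) (hΛ : 1 ≤ Λ) : ∃ M : ℝ, 0 ≤ M ∧
    ∀ (Y : Type uu) [MetricSpace Y] (A : Set Y) (q : Y → Y), QC Λ A q →
      ∀ (σ : ℝ → Y) (L : ℝ), IsGeodesicOn σ (Icc 0 L) → σ 0 ∈ A → σ L ∈ A →
      ∀ t ∈ Icc 0 L, dist (σ t) (q (σ t)) ≤ M := by
  set R := Λ * (4 * Λ + 1) with hR
  set B := 4 * (R + 1 + 2 * Λ) + 2 * Λ with hB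
  have hR0 : Λ ≤ R := by nlinarith
  have hB0 : 0 ≤ B := by linarith
  have hBL : 0 ≤ (1 + Λ) * B := by positivity
  refine ⟨R + 1 + 2 * Λ + (1 + Λ) * B + Λ, by linarith, ?_⟩
  intro Y _ A q hq σ L hσ h0 hL t ht
  have hA : ∀ a ∈ A, dist a (q a) ≤ R := by
    intro a ha
    have := hq.height a a ha
    rw [dist_self] at this
    linarith
  rcases le_or_gt (dist (σ t) (q (σ t))) R with hle | hgt
  · linarith
  obtain ⟨s1, hs1, P1, N1⟩ := last_exit (fun s => dist (σ s) (q (σ s)) ≤ R) 0 t ht.1 (hA _ h0)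
  obtain ⟨s2, hs2, P2, N2⟩ := first_entry (fun s => dist (σ s) (q (σ s)) ≤ R) t L ht.2 (hA _ hL)
  set u := min (s1 + 1) t with hu
  set v := max (s2 - 1) t with hv
  have hut : u ≤ t := min_le_right _ _
  have htv : t ≤ v := le_max_right _ _
  have hu1 : u ≤ s1 + 1 := min_le_left _ _
  have hu2 : s1 ≤ u := le_min (by linarith) hs1.2
  have hv1 : s2 - 1 ≤ v := le_max_left _ _
  have hv2 : v ≤ s2 := max_le (by linarith) hs2.1
  have hab : ∀ s ∈ Icc u v, R < dist (σ s) (q (σ s)) := by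
    intro s hs
    rcases lt_trichotomy s t with h | h | h
    · refine not_le.1 (N1 s ⟨?_, h.le⟩)
      rcases min_le_iff.1 hs.1 with h' | h'
      · exact h'
      · linarith
    · rw [h]; exact hgt
    · refine not_le.1 (N2 s ⟨h.le, ?_⟩)
      rcases le_max_iff.1 hs.2 with h' | h'
      · exact h'
      · linarith
  have mem : ∀ s ∈ Icc u v, s ∈ Icc 0 L := fun s hs =>
    ⟨by linarith [hs.1, hs1.1], by linarith [hs.2, hs2.2]⟩
  have mu : u ∈ Icc u v := ⟨le_rfl, by linarith⟩
  have mv : v ∈ Icc u v := ⟨by linarith, le_rfl⟩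
  have mt : t ∈ Icc u v := ⟨hut, htv⟩
  have m1 : s1 ∈ Icc 0 L := ⟨hs1.1, by linarith [hs1.2, ht.2]⟩
  have m2 : s2 ∈ Icc 0 L := ⟨by linarith [hs2.1, ht.1], hs2.2⟩
  have st := step_lemma (fun s => q (σ s)) (4 * Λ) Λ (by linarith) (by linarith) u v (by linarith)
    (by
      intro s hs s' hs' hss
      apply hq.contr
      rw [hσ (mem s hs) (mem s' hs')]
      have := hab s hs
      nlinarith)
  have e : Λ * ((v - u) / (4 * Λ) + 1) = (v - u) / 4 + Λ := by field_simp
  simp only [e] at st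
  have hhu := hq.h_lip (σ u) (σ s1)
  rw [hσ (mem u mu) m1, abs_of_nonneg (by linarith)] at hhu
  have hhv := hq.h_lip (σ v) (σ s2)
  rw [hσ (mem v mv) m2, abs_sub_comm, abs_of_nonneg (by linarith)] at hhv
  have hhu' : dist (σ u) (q (σ u)) ≤ R + 1 + 2 * Λ := by nlinarith
  have hhv' : dist (σ v) (q (σ v)) ≤ R + 1 + 2 * Λ := by nlinarith
  have huv : v - u ≤ B := by
    have d := dist_triangle4 (σ u) (q (σ u)) (q (σ v)) (σ v)
    rw [hσ (mem u mu) (mem v mv), abs_sub_comm, abs_of_nonneg (by linarith),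
      dist_comm (q (σ v)) (σ v)] at d
    linarith
  have hht := hq.h_lip (σ t) (σ u)
  rw [hσ (mem t mt) (mem u mu), abs_of_nonneg (by linarith)] at hht
  have : (1 + Λ) * (t - u) ≤ (1 + Λ) * B := by
    apply mul_le_mul_of_nonneg_left <;> linarith
  linarith

theorem reverse_lemma (Λ : ℝ) (hΛ : 1 ≤ Λ) : ∃ M : ℝ, 0 ≤ M ∧
    ∀ (Y : Type uu) [MetricSpace Y] (α : ℝ → Y) (τ : Y → ℝ), (∀ y, 0 ≤ τ y) →
      QC Λ (α '' Ici 0) (fun y => α (τ y)) →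
      (∀ s ∈ Ici (0:ℝ), ∀ t ∈ Ici (0:ℝ), |s - t| ≤ Λ * dist (α s) (α t) + Λ) →
      (∀ s ∈ Ici (0:ℝ), ∀ t ∈ Ici (0:ℝ), dist (α s) (α t) ≤ Λ * |s - t| + Λ) →
      ∀ (σ : ℝ → Y) (L n : ℝ), 0 ≤ L → IsGeodesicOn σ (Icc 0 L) → σ 0 = α 0 → σ L = α n →
      ∀ t, 0 ≤ t → t ≤ n → ∃ s ∈ Icc 0 L, dist (α t) (σ s) ≤ M := by
  obtain ⟨M, hM, h⟩ := morse_lemma.{uu} Λ hΛ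
  refine ⟨Λ * (3 * Λ ^ 2 + 2 * Λ) + Λ + M, by positivity, ?_⟩
  intro Y _ α τ hτ hq hlow hup σ L n hL hσ h0 hn t ht htn
  have hn0 : 0 ≤ n := ht.trans htn
  have hA0 : σ 0 ∈ α '' Ici 0 := ⟨0, Set.self_mem_Ici, h0.symm⟩
  have hAn : σ L ∈ α '' Ici 0 := ⟨n, hn0, hn.symm⟩
  have hmo := h Y _ _ hq σ L hσ hA0 hAn
  have t0 : |τ (σ 0) - 0| ≤ Λ ^ 2 + Λ := by
    have e1 := hlow (τ (σ 0)) (hτ _) 0 Set.self_mem_Ici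
    have e2 := hq.height (σ 0) _ hA0
    simp only [dist_self] at e2
    rw [← h0, dist_comm] at e1
    nlinarith
  have tn : |τ (σ L) - n| ≤ Λ ^ 2 + Λ := by
    have e1 := hlow (τ (σ L)) (hτ _) n hn0
    have e2 := hq.height (σ L) _ hAn
    simp only [dist_self] at e2
    rw [← hn, dist_comm] at e1
    nlinarith
  rw [abs_le] at t0 tn
  obtain ⟨s, hs, P, N⟩ := last_exit (fun s => τ (σ s) ≤ t + Λ ^ 2 + Λ) 0 L hL (by linarith)
  have hs' : min (s + 1) L ∈ Icc 0 L := ⟨le_min (by linarith [hs.1]) hL, min_le_right _ _⟩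
  have low : t - Λ ^ 2 - Λ ≤ τ (σ (min (s + 1) L)) := by
    rcases le_total (s + 1) L with hc | hc
    · rw [min_eq_left hc]
      have := N (s + 1) ⟨le_rfl, hc⟩
      push Not at this
      nlinarith
    · rw [min_eq_right hc]; linarith
  have d1 : dist (σ s) (σ (min (s+1) L)) ≤ 1 := by
    rw [hσ hs hs', abs_sub_comm, abs_of_nonneg]
    · linarith [min_le_left (s+1) L]
    · linarith [le_min (by linarith : s ≤ s + 1) hs.2]
  have d2 := hq.lip (σ s) (σ (min (s+1) L))
  have d3 := hlow _ (hτ (σ s)) _ (hτ (σ (min (s+1) L)))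
  have d4 : dist (α (τ (σ s))) (α (τ (σ (min (s+1) L)))) ≤ 2 * Λ := by
    nlinarith
  have d5 : |τ (σ s) - τ (σ (min (s+1) L))| ≤ 2 * Λ ^ 2 + Λ := by nlinarith
  rw [abs_le] at d5
  have d6 : |t - τ (σ s)| ≤ 3 * Λ ^ 2 + 2 * Λ := by
    rw [abs_le]; constructor <;> nlinarith
  refine ⟨s, hs, ?_⟩
  have d7 := hup t ht _ (hτ (σ s))
  have d8 : Λ * |t - τ (σ s)| ≤ Λ * (3 * Λ ^ 2 + 2 * Λ) := by gcongr
  have d9 := hmo s hs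
  have d10 := dist_triangle_right (α t) (σ s) (α (τ (σ s)))
  linarith

theorem limit_ray (Λ : ℝ) (hΛ : 1 ≤ Λ) : ∃ M : ℝ, 0 ≤ M ∧
    ∀ (Y : Type uu) [MetricSpace Y] [CAT0Space Y] [CompleteSpace Y] (α : ℝ → Y) (τ : Y → ℝ),
      (∀ y, 0 ≤ τ y) → QC Λ (α '' Ici 0) (fun y => α (τ y)) →
      (∀ s ∈ Ici (0:ℝ), ∀ t ∈ Ici (0:ℝ), |s - t| ≤ Λ * dist (α s) (α t) + Λ) →
      (∀ s ∈ Ici (0:ℝ), ∀ t ∈ Ici (0:ℝ), dist (α s) (α t) ≤ Λ * |s - t| + Λ) →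
      ∃ β : ℝ → Y, β 0 = α 0 ∧ IsGeodesicOn β (Ici 0) ∧
        HausdorffLE (α '' Ici 0) (β '' Ici 0) M := by
  obtain ⟨M1, hM1, h1⟩ := morse_lemma.{uu} Λ hΛ
  obtain ⟨M2, hM2, h2⟩ := reverse_lemma.{uu} Λ hΛ
  refine ⟨2 * M2 + M1 + 1, by positivity, ?_⟩
  intro Y _ _ _ α τ hτ hq hlow hup
  have hex : ∀ n : ℕ, ∃ σ : ℝ → Y, σ 0 = α 0 ∧ σ (dist (α 0) (α n)) = α n ∧
    IsGeodesicOn σ (Icc 0 (dist (α 0) (α n))) := fun n => GeodesicSpace.geodesic _ _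
  choose σ hσ0 hσ1 hσ using hex
  have hLbig : ∀ T : ℝ, ∀ᶠ n : ℕ in Filter.atTop, T ≤ dist (α 0) (α n) := by
    intro T
    filter_upwards [Filter.eventually_ge_atTop ⌈Λ * T + Λ⌉₊] with n hn
    have e1 : Λ * T + Λ ≤ n := (Nat.le_ceil _).trans (by exact_mod_cast hn)
    have e2 := hlow 0 Set.self_mem_Ici n (Nat.cast_nonneg n : (0:ℝ) ≤ n)
    rw [zero_sub, abs_neg, abs_of_nonneg (Nat.cast_nonneg n : (0:ℝ) ≤ n)] at e2
    have : Λ * T ≤ Λ * dist (α 0) (α n) := by linarith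
    exact le_of_mul_le_mul_left this (by linarith)
  have near : ∀ t : ℝ, 0 ≤ t → ∀ n : ℕ, t ≤ n → dist (α 0) (α t) ≤ dist (α 0) (α n) →
      dist (α t) (σ n (dist (α 0) (α t))) ≤ 2 * M2 := by
    intro t ht n htn hle
    obtain ⟨s, hs, hd⟩ := h2 Y α τ hτ hq hlow hup (σ n) _ n dist_nonneg (hσ n) (hσ0 n) (hσ1 n)
      t ht htn
    have e1 : dist (α 0) (σ n s) = s := by
      rw [← hσ0 n, hσ n ⟨le_rfl, dist_nonneg⟩ hs, zero_sub, abs_neg, abs_of_nonneg hs.1]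
    have e2 : |s - dist (α 0) (α t)| ≤ M2 := by
      rw [← e1, abs_le]
      have a1 := dist_triangle (α 0) (α t) (σ n s)
      have a2 := dist_triangle_right (α 0) (α t) (σ n s)
      constructor <;> linarith
    have e3 := hσ n hs ⟨dist_nonneg, hle⟩
    have := dist_triangle (α t) (σ n s) (σ n (dist (α 0) (α t)))
    linarith
  have cau : ∀ t, 0 ≤ t → CauchySeq (fun n => σ n t) := by
    intro t ht
    rw [Metric.cauchySeq_iff]
    intro e he
    obtain ⟨m, hm⟩ := (hLbig (max (t + 1) (4 * t * M2 / e + 1))).exists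
    have hm1 : t + 1 ≤ dist (α 0) (α m) := (le_max_left _ _).trans hm
    have hm2 : 4 * t * M2 / e + 1 ≤ dist (α 0) (α m) := (le_max_right _ _).trans hm
    set Lm := dist (α 0) (α m) with hLm
    have hLm0 : 0 < Lm := by linarith
    have comp : ∀ᶠ n : ℕ in Filter.atTop, dist (σ n t) (σ m t) < e / 2 := by
      filter_upwards [hLbig Lm, Filter.eventually_ge_atTop m] with n hn hmn
      have e1 := near m (Nat.cast_nonneg m) n (by exact_mod_cast hmn) hn
      have e2 := cat0_fan (σ n) (σ m) Lm hLm0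
        (fun u hu v hv => hσ n ⟨hu.1, hu.2.trans hn⟩ ⟨hv.1, hv.2.trans hn⟩) (hσ m)
        (by rw [hσ0, hσ0]) t ⟨ht, by linarith⟩
      rw [hσ1 m, dist_comm (σ n Lm)] at e2
      have e3 : t / Lm * dist (α m) (σ n Lm) ≤ t / Lm * (2 * M2) := by gcongr
      have e4 : t / Lm * (2 * M2) < e / 2 := by
        rw [div_mul_eq_mul_div, div_lt_iff₀ hLm0]
        have : 4 * t * M2 / e < Lm := by linarith
        rw [div_lt_iff₀ he] at this
        linarith
      linarith
    obtain ⟨N, hN⟩ := Filter.eventually_atTop.1 comp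
    refine ⟨N, fun i hi j hj => ?_⟩
    have := dist_triangle_right (σ i t) (σ j t) (σ m t)
    linarith [hN i hi, hN j hj]
  have hlim : ∀ t, ∃ y, 0 ≤ t → Filter.Tendsto (fun n => σ n t) Filter.atTop (𝓝 y) := by
    intro t
    rcases le_or_gt 0 t with h | h
    · obtain ⟨y, hy⟩ := cauchySeq_tendsto_of_complete (cau t h)
      exact ⟨y, fun _ => hy⟩
    · exact ⟨α 0, fun h' => absurd h' (not_le.2 h)⟩
  choose β hβ using hlim
  refine ⟨β, ?_, ?_, ?_, ?_⟩
  · have := hβ 0 le_rfl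
    simp only [hσ0] at this
    exact tendsto_nhds_unique this tendsto_const_nhds
  · intro s hs t ht
    have e := (hβ s hs).dist (hβ t ht)
    refine tendsto_nhds_unique e (tendsto_const_nhds.congr' ?_)
    filter_upwards [hLbig s, hLbig t] with n h1 h2
    rw [hσ n ⟨hs, h1⟩ ⟨ht, h2⟩]
  · rintro _ ⟨t, ht, rfl⟩
    refine ⟨β (dist (α 0) (α t)), ⟨_, dist_nonneg, rfl⟩, ?_⟩
    have e : Filter.Tendsto (fun n => dist (α t) (σ n (dist (α 0) (α t)))) Filter.atTop
      (𝓝 (dist (α t) (β (dist (α 0) (α t))))) :=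
      tendsto_const_nhds.dist (hβ _ dist_nonneg)
    have : dist (α t) (β (dist (α 0) (α t))) ≤ 2 * M2 := by
      apply le_of_tendsto e
      filter_upwards [hLbig (dist (α 0) (α t)), Filter.eventually_ge_atTop ⌈t⌉₊] with n h1 h2
      exact near t ht n ((Nat.le_ceil t).trans (by exact_mod_cast h2)) h1
    linarith
  · rintro _ ⟨t, ht, rfl⟩
    have e := (Metric.tendsto_nhds.1 (hβ t ht)) 1 one_pos
    obtain ⟨n, hn1, hn2⟩ := (e.and (hLbig t)).exists
    refine ⟨α (τ (σ n t)), ⟨_, hτ _, rfl⟩, ?_⟩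
    have := h1 Y _ _ hq (σ n) _ (hσ n) ⟨0, Set.self_mem_Ici, (hσ0 n).symm⟩
      ⟨n, (Nat.cast_nonneg n : (0:ℝ) ≤ n), (hσ1 n).symm⟩ t ⟨ht, hn2⟩
    have d := dist_triangle_left (α (τ (σ n t))) (β t) (σ n t)
    linarith

theorem ray_unique {Y : Type*} [MetricSpace Y] [CAT0Space Y] (A : Set Y) (β β' : ℝ → Y)
    (h0 : β' 0 = β 0) (hβ : IsGeodesicOn β (Ici 0)) (hβ' : IsGeodesicOn β' (Ici 0)) (C C' : ℝ)
    (h : HausdorffLE A (β '' Ici 0) C) (h' : HausdorffLE A (β' '' Ici 0) C') :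
    ∀ t ∈ Ici (0:ℝ), β' t = β t := by
  have bd : ∀ t ∈ Ici (0:ℝ), dist (β' t) (β t) ≤ 2 * (C + C') := by
    intro t ht
    obtain ⟨a, ha, hd⟩ := h'.2 (β' t) ⟨t, ht, rfl⟩
    obtain ⟨_, ⟨s, hs, rfl⟩, hd'⟩ := h.1 a ha
    have e1 := dist_triangle_left (β' t) (β s) a
    have z : (0:ℝ) ∈ Ici (0:ℝ) := Set.self_mem_Ici
    have t1 : dist (β' 0) (β' t) = t := by
      rw [hβ' z ht, zero_sub, abs_neg, abs_of_nonneg ht]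
    have t2 : dist (β 0) (β s) = s := by
      rw [hβ z hs, zero_sub, abs_neg, abs_of_nonneg hs]
    have e2 : |s - t| ≤ C + C' := by
      have a1 := dist_triangle (β' 0) (β' t) (β s)
      have a2 := dist_triangle_right (β' 0) (β' t) (β s)
      rw [h0] at a1 a2 t1
      rw [abs_le]; constructor <;> linarith
    have e3 := hβ hs ht
    linarith [dist_triangle (β' t) (β s) (β t)]
  intro t ht
  by_contra hne
  have hpos : 0 < dist (β' t) (β t) := dist_pos.2 hne
  set d := dist (β' t) (β t) with hd
  have ht0 : (0:ℝ) ≤ t := ht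
  have hB := bd t ht
  set L := t * (2 * (C + C')) / d + t + 1 with hL
  have hp : 0 ≤ t * (2 * (C + C')) / d :=
    div_nonneg (mul_nonneg ht0 (by linarith)) hpos.le
  have hL0 : 0 < L := by linarith
  have e := cat0_fan β' β L hL0 (fun u hu v hv => hβ' hu.1 hv.1) (fun u hu v hv => hβ hu.1 hv.1)
    h0 t ⟨ht0, by linarith⟩
  have e2 : t / L * dist (β' L) (β L) ≤ t / L * (2 * (C + C')) := by
    gcongr; exact bd L hL0.le
  have e3 : t / L * (2 * (C + C')) < d := by
    rw [div_mul_eq_mul_div, div_lt_iff₀ hL0]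
    have : t * (2 * (C + C')) / d < L := by linarith
    rw [div_lt_iff₀ hpos] at this
    linarith
  linarith

theorem ray_proj {Y : Type*} [MetricSpace Y] (β : ℝ → Y) (hβ : IsGeodesicOn β (Ici 0)) :
    ∃ p : Y → Y, IsProjOn p (β '' Ici 0) := by
  have : ∀ y, ∃ a, a ∈ β '' Ici 0 ∧ ∀ b ∈ β '' Ici 0, dist y a ≤ dist y b := by
    intro y
    set T := 2 * dist y (β 0) with hT
    have hT0 : 0 ≤ T := by positivity
    have cont : ContinuousOn (fun s => dist y (β s)) (Icc 0 T) := by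
      have : LipschitzOnWith 1 β (Icc 0 T) := by
        apply LipschitzOnWith.of_dist_le_mul
        intro s hs t ht
        rw [NNReal.coe_one, one_mul, Real.dist_eq, hβ hs.1 ht.1]
      exact (continuous_const.dist continuous_id).comp_continuousOn this.continuousOn
    obtain ⟨m, hm, hmin⟩ := isCompact_Icc.exists_isMinOn ⟨0, ⟨le_rfl, hT0⟩⟩ cont
    refine ⟨β m, ⟨m, hm.1, rfl⟩, ?_⟩
    rintro _ ⟨s, hs, rfl⟩
    rcases le_total s T with h | h
    · exact hmin (⟨hs, h⟩ : s ∈ Icc 0 T)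
    · have e1 : dist y (β m) ≤ dist y (β 0) := hmin (⟨le_rfl, hT0⟩ : (0:ℝ) ∈ Icc 0 T)
      have e2 : dist (β 0) (β s) = s := by
        rw [hβ (show (0:ℝ) ∈ Ici (0:ℝ) from Set.self_mem_Ici) hs, zero_sub, abs_neg, abs_of_nonneg hs]
      have := dist_triangle_left (β 0) (β s) y
      linarith
  choose p hp using this
  exact ⟨p, hp⟩

theorem contracting_lip {X : Type*} [MetricSpace X] {D : ℝ} {π : X → X} {A : Set X}
    (h : IsContractingWith D π A) (x y : X) :
    dist (π x) (π y) ≤ max D 0 + 4 * dist x y := by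
  have hd : 0 ≤ dist x y := dist_nonneg
  have hD0 := le_max_right D 0
  have hD1 := le_max_left D 0
  rcases lt_or_ge (dist x y) (dist x (π x)) with hlt | hge
  · linarith [h.2 x y hlt]
  · have e1 := (h.1 y).2 _ (h.1 x).1
    have e2 := dist_triangle_left y (π x) x
    have e3 := dist_triangle4 (π x) x y (π y)
    rw [dist_comm (π x) x] at e3
    linarith

/-- The pushed-forward projection is coarsely contracting. -/
theorem push_QC (lam eps D : ℝ) (hlam : 1 ≤ lam) (heps : 0 ≤ eps) : ∃ Λ : ℝ, 1 ≤ Λ ∧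
    lam ≤ Λ ∧ lam * eps ≤ Λ ∧ eps ≤ Λ ∧
    ∀ (X Y : Type*) [MetricSpace X] [MetricSpace Y] (f : X → Y), IsQIEmbedding lam eps f →
      ∀ g : Y → X, (∀ y, dist (f (g y)) y ≤ eps) →
      ∀ (A : Set X) (π : X → X), IsContractingWith D π A →
        QC Λ (f '' A) (fun y => f (π (g y))) := by
  set D0 := max D 0 with hD0
  have hD00 : 0 ≤ D0 := le_max_right _ _
  have hDD : D ≤ D0 := le_max_left _ _
  have p1 : 0 ≤ lam * D0 := by positivity
  have p2 : 0 ≤ lam ^ 2 * eps := by positivity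
  have p3 : 0 ≤ lam * eps := by positivity
  have p4 : lam ≤ lam ^ 2 := by nlinarith
  have p5 : lam * eps ≤ lam ^ 2 * eps := mul_le_mul_of_nonneg_right p4 heps
  refine ⟨4 * lam ^ 2 + lam * D0 + 12 * (lam ^ 2 * eps) + 3 * eps + 1, by nlinarith, by nlinarith,
    by nlinarith, by nlinarith, ?_⟩
  intro X Y _ _ f hf g hg A π hπ
  set Λ := 4 * lam ^ 2 + lam * D0 + 12 * (lam ^ 2 * eps) + 3 * eps + 1 with hΛ
  have low : ∀ s t : X, dist s t ≤ lam * (dist (f s) (f t) + eps) := by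
    intro s t
    have := (hf s t).1
    have h2 : dist s t / lam ≤ dist (f s) (f t) + eps := by linarith
    rwa [div_le_iff₀ (by linarith), mul_comm] at h2
  have gg : ∀ y z, dist (g y) (g z) ≤ lam * (dist y z + 3 * eps) := by
    intro y z
    refine (low _ _).trans ?_
    have := dist_triangle4 (f (g y)) y z (f (g z))
    rw [dist_comm z] at this
    have : dist (f (g y)) (f (g z)) + eps ≤ dist y z + 3 * eps := by linarith [hg y, hg z]
    gcongr
  have hh : ∀ y, dist y (f (π (g y))) ≤ lam * dist (g y) (π (g y)) + 2 * eps := by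
    intro y
    have e1 := dist_triangle_left y (f (π (g y))) (f (g y))
    linarith [hg y, (hf (g y) (π (g y))).2]
  refine ⟨by nlinarith, ?_, ?_, ?_, ?_⟩
  · intro y
    exact ⟨_, ⟨_, (hπ.1 (g y)).1, rfl⟩, by simp only [dist_self]; nlinarith⟩
  · rintro y _ ⟨a, ha, rfl⟩
    have e1 := hh y
    have e2 := (hπ.1 (g y)).2 a ha
    have e3 := low (g y) a
    have e4 := dist_triangle (f (g y)) y (f a)
    have e5 : dist (g y) a ≤ lam * (dist y (f a) + 2 * eps) := by
      refine e3.trans ?_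
      have : dist (f (g y)) (f a) + eps ≤ dist y (f a) + 2 * eps := by linarith [hg y]
      gcongr
    have e6 : lam * dist (g y) (π (g y)) ≤ lam * (lam * (dist y (f a) + 2 * eps)) := by
      have := e2.trans e5
      gcongr
    have hd : 0 ≤ dist y (f a) := dist_nonneg
    have e7 : lam ^ 2 * dist y (f a) ≤ Λ * dist y (f a) := by
      apply mul_le_mul_of_nonneg_right _ hd
      nlinarith
    nlinarith
  · intro y z
    have e1 := (hf (π (g y)) (π (g z))).2
    have e2 := contracting_lip hπ (g y) (g z)
    have e3 := gg y z
    have e4 : lam * dist (π (g y)) (π (g z)) ≤ lam * (D0 + 4 * (lam * (dist y z + 3 * eps))) := by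
      have : dist (π (g y)) (π (g z)) ≤ D0 + 4 * (lam * (dist y z + 3 * eps)) := by linarith
      gcongr
    have hd : 0 ≤ dist y z := dist_nonneg
    have e7 : 4 * lam ^ 2 * dist y z ≤ Λ * dist y z := by
      apply mul_le_mul_of_nonneg_right _ hd
      nlinarith
    nlinarith
  · intro y z hyz
    have e1 := hh y
    have e3 := gg y z
    have hd : 0 ≤ dist y z := dist_nonneg
    have hlt : dist (g y) (g z) < dist (g y) (π (g y)) := by
      have a1 : lam * (lam * (dist y z + 3 * eps)) + 2 * eps < Λ * (dist y z + 1) := by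
        have : lam ^ 2 * dist y z ≤ Λ * dist y z := by
          apply mul_le_mul_of_nonneg_right _ hd
          nlinarith
        nlinarith
      have a2 : lam * dist (g y) (g z) ≤ lam * (lam * (dist y z + 3 * eps)) := by gcongr
      have a3 : lam * dist (g y) (g z) < lam * dist (g y) (π (g y)) := by
        linarith
      exact lt_of_mul_lt_mul_left a3 (by linarith)
    have e4 := hπ.2 _ _ hlt
    have e5 := (hf (π (g y)) (π (g z))).2
    have e6 : lam * dist (π (g y)) (π (g z)) ≤ lam * D0 := by
      have : dist (π (g y)) (π (g z)) ≤ D0 := by linarith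
      gcongr
    nlinarith

/-- a `(lam,eps)`-quasi-isometry `f : X → Y` of CAT(0) spaces with `Y` complete
sends a `D`-contracting geodesic ray `γ` based at `x₀` to a path at bounded Hausdorff
distance from a unique geodesic ray `β` based at `f x₀`, and `β` is `D'`-contracting with
`D'` depending only on `lam`, `eps`, `D`. -/
theorem stmt6 (lam eps D : ℝ) (hlam : 1 ≤ lam) (heps : 0 ≤ eps) :
    ∃ D' : ℝ,
      ∀ (X : Type*) (Y : Type*) [MetricSpace X] [CAT0Space X]
        [MetricSpace Y] [CAT0Space Y] [CompleteSpace Y]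
        (f : X → Y), IsQuasiIsometry lam eps f →
        ∀ (x₀ : X) (γ : ℝ → X), γ 0 = x₀ → IsGeodesicOn γ (Set.Ici 0) →
        ∀ π : X → X, IsContractingWith D π (γ '' Set.Ici 0) →
        ∃ β : ℝ → Y, β 0 = f x₀ ∧ IsGeodesicOn β (Set.Ici 0) ∧
          (∃ C : ℝ, HausdorffLE ((f ∘ γ) '' Set.Ici 0) (β '' Set.Ici 0) C) ∧
          (∀ β' : ℝ → Y, β' 0 = f x₀ → IsGeodesicOn β' (Set.Ici 0) →
            (∃ C : ℝ, HausdorffLE ((f ∘ γ) '' Set.Ici 0) (β' '' Set.Ici 0) C) →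
            ∀ t ∈ Set.Ici (0:ℝ), β' t = β t) ∧
          ∃ π' : Y → Y, IsContractingWith D' π' (β '' Set.Ici 0) := by
  obtain ⟨Λ, hΛ, hl1, hl2, hl3, hpush⟩ := push_QC lam eps D hlam heps
  obtain ⟨M, hM, hlimit⟩ := limit_ray Λ hΛ
  have hΛM : 0 ≤ Λ * M := by positivity
  obtain ⟨D', hD'⟩ := full_contr (Λ * (1 + M) + Λ + M) (by nlinarith)
  refine ⟨D', ?_⟩
  intro X Y _ _ _ _ _ f hf x₀ γ hγ0 hγ π hπ
  choose g hg using hf.2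
  have hq := hpush X Y f hf.1 g hg _ π hπ
  have hex : ∀ y : Y, ∃ t : ℝ, 0 ≤ t ∧ γ t = π (g y) := fun y => by
    obtain ⟨t, ht, e⟩ := (hπ.1 (g y)).1
    exact ⟨t, ht, e⟩
  choose τ hτ hτe using hex
  have hq' : QC Λ ((f ∘ γ) '' Set.Ici 0) (fun y => (f ∘ γ) (τ y)) := by
    have e : (fun y => (f ∘ γ) (τ y)) = fun y => f (π (g y)) := by
      funext y; simp [hτe]
    rw [e, Set.image_comp]; exact hq
  obtain ⟨β, hβ0, hβ, hβH⟩ := hlimit Y (f ∘ γ) τ hτ hq'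
    (by
      intro s hs t ht
      have h1 := (hf.1 (γ s) (γ t)).1
      rw [hγ hs ht] at h1
      have h2 : |s - t| / lam ≤ dist (f (γ s)) (f (γ t)) + eps := by linarith
      rw [div_le_iff₀ (by linarith)] at h2
      have h3 : lam * dist (f (γ s)) (f (γ t)) ≤ Λ * dist (f (γ s)) (f (γ t)) := by gcongr
      simp only [Function.comp]
      linarith)
    (by
      intro s hs t ht
      have h1 := (hf.1 (γ s) (γ t)).2
      rw [hγ hs ht] at h1
      have h3 : lam * |s - t| ≤ Λ * |s - t| := by gcongr
      simp only [Function.comp]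
      linarith)
  refine ⟨β, by rw [hβ0, Function.comp, hγ0], hβ, ⟨M, hβH⟩, ?_, ?_⟩
  · rintro β' h0 hβ' ⟨C, hC⟩
    exact ray_unique _ β β' (by rw [h0, hβ0, Function.comp, hγ0]) hβ hβ' M C hβH hC
  · obtain ⟨p, hp⟩ := ray_proj β hβ
    refine ⟨p, hD' Y _ (fun y => (f ∘ γ) (τ y)) ?_ p hp⟩
    have hle : Λ ≤ Λ * (1 + M) + Λ + M := by nlinarith
    refine ⟨by linarith, ?_, ?_, ?_, ?_⟩
    · intro y
      obtain ⟨b, hb, hd⟩ := hβH.1 _ ⟨τ y, hτ y, rfl⟩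
      exact ⟨b, hb, by nlinarith⟩
    · intro y b hb
      obtain ⟨a, ha, hd⟩ := hβH.2 b hb
      have e1 := hq'.height y a ha
      have e2 := dist_triangle_right y a b
      have e3 : Λ * dist y a ≤ Λ * (dist y b + M) := by gcongr; linarith
      have e4 : Λ * dist y b ≤ (Λ * (1 + M) + Λ + M) * dist y b := by gcongr
      nlinarith
    · intro y z
      have e1 := hq'.lip y z
      have e4 : Λ * dist y z ≤ (Λ * (1 + M) + Λ + M) * dist y z := by gcongr
      linarith
    · intro y z h
      have e4 : Λ * (dist y z + 1) ≤ (Λ * (1 + M) + Λ + M) * (dist y z + 1) := by gcongr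
      exact (hq'.contr y z (e4.trans h)).trans hle
end

section
/- Let α and β be distinct geodesic rays based at the same point x₀ in a complete CAT(0) space, with α contracting. Then the nearest-point projection of β onto α is bounded, and there exists a bi-infinite geodesic γ with γ(∞) = α(∞) and γ(−∞) = β(∞). -/
open Set Metric Topology
open scoped ENNReal

section helpers
variable {X : Type*} [MetricSpace X]

lemma cn_mid_dist [CAT0Space X] (x y z m : X) (h1 : dist y m = dist y z / 2)
    (h2 : dist z m = dist y z / 2) : dist x m ≤ (dist x y + dist x z) / 2 := by
  have h := CAT0Space.cn x y z m h1 h2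
  have t1 := dist_triangle_left y z x
  have t2 := dist_triangle x y z
  have t3 := dist_triangle_right x z y
  have t4 := dist_triangle x z y
  rw [dist_comm z y] at t4
  have hp : 0 ≤ dist x y + dist x z := by positivity
  have hab : (dist x y - dist x z) ^ 2 ≤ dist y z ^ 2 := by
    apply sq_le_sq'
    · linarith
    · linarith
  apply le_of_sq_le_sq _ (by linarith)
  nlinarith
  
lemma tri_mid [CAT0Space X] (a b c m n : X) (h1 : dist a m = dist a b / 2)
    (h2 : dist b m = dist a b / 2) (h3 : dist c n = dist c b / 2)
    (h4 : dist b n = dist c b / 2) : dist m n ≤ dist a c / 2 := by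
  have e1 := CAT0Space.cn m c b n h3 h4
  have e2 := CAT0Space.cn c a b m h1 h2
  rw [dist_comm m c, dist_comm m b, h2] at e1
  rw [dist_comm c a] at e2
  apply le_of_sq_le_sq _ (by positivity)
  nlinarith

lemma exists_mid [CAT0Space X] (a b : X) :
    ∃ m, dist a m = dist a b / 2 ∧ dist b m = dist a b / 2 := by
  obtain ⟨γ, h0, h1, hg⟩ := GeodesicSpace.geodesic a b
  have hd : (0:ℝ) ≤ dist a b := dist_nonneg
  refine ⟨γ (dist a b / 2), ?_, ?_⟩
  · have := hg (show (0:ℝ) ∈ Icc 0 (dist a b) by constructor <;> linarith)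
      (show dist a b / 2 ∈ Icc 0 (dist a b) by constructor <;> linarith)
    rw [h0] at this
    rw [this, zero_sub, abs_neg, abs_of_nonneg (by linarith)]
  · have := hg (show dist a b ∈ Icc 0 (dist a b) by constructor <;> linarith)
      (show dist a b / 2 ∈ Icc 0 (dist a b) by constructor <;> linarith)
    rw [h1] at this
    rw [this, abs_of_nonneg (by linarith)]
    ring

lemma quad_mid [CAT0Space X] (a b c d m n : X) (h1 : dist a m = dist a b / 2)
    (h2 : dist b m = dist a b / 2) (h3 : dist c n = dist c d / 2)
    (h4 : dist d n = dist c d / 2) : dist m n ≤ (dist a c + dist b d) / 2 := by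
  obtain ⟨k, k1, k2⟩ := exists_mid c b
  have e1 := tri_mid a b c m k h1 h2 k1 k2
  have e2 := tri_mid b c d k n (by rw [k2, dist_comm b c]) (by rw [k1, dist_comm b c])
    (by rw [h4, dist_comm d c]) (by rw [h3, dist_comm d c])
  linarith [dist_triangle m k n]

/-- a continuous midpoint-convex function which is nonpositive at the endpoints is nonpositive -/
lemma mid_nonpos (g : ℝ → ℝ) (hc : ContinuousOn g (Icc 0 1))
    (hm : ∀ s ∈ Icc (0:ℝ) 1, ∀ t ∈ Icc (0:ℝ) 1, g ((s + t) / 2) ≤ (g s + g t) / 2)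
    (h0 : g 0 ≤ 0) (h1 : g 1 ≤ 0) : ∀ s ∈ Icc (0:ℝ) 1, g s ≤ 0 := by
  intro s hs
  by_contra! hpos
  obtain ⟨w, hw, hmax⟩ := isCompact_Icc.exists_isMaxOn ⟨s, hs⟩ hc
  have hS : IsCompact (Icc (0:ℝ) 1 ∩ g ⁻¹' (Ici (g w))) :=
    isCompact_Icc.of_isClosed_subset (hc.preimage_isClosed_of_isClosed isClosed_Icc isClosed_Ici)
      inter_subset_left
  obtain ⟨v, ⟨hv, hvw⟩, hleast⟩ := hS.exists_isLeast ⟨w, hw, le_refl (g w)⟩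
  have hvw' : g w ≤ g v := hvw
  have hsw : g s ≤ g w := hmax hs
  have hv0 : v ≠ 0 := by rintro rfl; linarith
  have hv1 : v ≠ 1 := by rintro rfl; linarith
  have hv0' : 0 < v := lt_of_le_of_ne hv.1 (Ne.symm hv0)
  have hv1' : v < 1 := lt_of_le_of_ne hv.2 hv1
  obtain ⟨δ, hδ, hδ1, hδ2⟩ : ∃ δ, 0 < δ ∧ δ ≤ v ∧ δ ≤ 1 - v :=
    ⟨min v (1 - v), lt_min hv0' (by linarith), min_le_left _ _, min_le_right _ _⟩
  have ha : v - δ ∈ Icc (0:ℝ) 1 := ⟨by linarith, by linarith⟩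
  have hb : v + δ ∈ Icc (0:ℝ) 1 := ⟨by linarith, by linarith⟩
  have h := hm _ ha _ hb
  rw [show (v - δ + (v + δ)) / 2 = v by ring] at h
  have h2 : g (v + δ) ≤ g w := hmax hb
  have h3 : g (v - δ) < g w := by
    by_contra! hcon
    have := hleast ⟨ha, hcon⟩
    linarith
  linarith

lemma conv_dist [CAT0Space X] (σ τ : ℝ → X) (L M : ℝ) (hL : 0 ≤ L) (hM : 0 ≤ M)
    (hσ : ∀ s ∈ Icc (0:ℝ) 1, ∀ t ∈ Icc (0:ℝ) 1, dist (σ s) (σ t) = |s - t| * L)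
    (hτ : ∀ s ∈ Icc (0:ℝ) 1, ∀ t ∈ Icc (0:ℝ) 1, dist (τ s) (τ t) = |s - t| * M) :
    ∀ s ∈ Icc (0:ℝ) 1,
      dist (σ s) (τ s) ≤ (1 - s) * dist (σ 0) (τ 0) + s * dist (σ 1) (τ 1) := by
  have key : ∀ (ρ : ℝ → X) (N : ℝ), 0 ≤ N →
      (∀ s ∈ Icc (0:ℝ) 1, ∀ t ∈ Icc (0:ℝ) 1, dist (ρ s) (ρ t) = |s - t| * N) →
      ContinuousOn ρ (Icc 0 1) := by
    intro ρ N hN h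
    have : LipschitzOnWith (Real.toNNReal N) ρ (Icc 0 1) := by
      apply LipschitzOnWith.of_dist_le_mul
      intro x hx y hy
      rw [h x hx y hy, Real.dist_eq, Real.coe_toNNReal _ hN, mul_comm]
    exact this.continuousOn
  have key2 : ∀ (ρ : ℝ → X) (N : ℝ), 
      (∀ s ∈ Icc (0:ℝ) 1, ∀ t ∈ Icc (0:ℝ) 1, dist (ρ s) (ρ t) = |s - t| * N) →
      ∀ s ∈ Icc (0:ℝ) 1, ∀ t ∈ Icc (0:ℝ) 1, 
        dist (ρ s) (ρ ((s + t) / 2)) = dist (ρ s) (ρ t) / 2 ∧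
        dist (ρ t) (ρ ((s + t) / 2)) = dist (ρ s) (ρ t) / 2 := by
    intro ρ N h s hs t ht
    have hm : (s + t) / 2 ∈ Icc (0:ℝ) 1 := ⟨by linarith [hs.1, ht.1], by linarith [hs.2, ht.2]⟩
    rw [h s hs _ hm, h t ht _ hm, h s hs t ht]
    rw [show s - (s + t) / 2 = (s - t) / 2 by ring, show t - (s + t) / 2 = -((s - t) / 2) by ring,
      abs_neg, abs_div, abs_two]
    constructor <;> ring
  intro s hs
  have := mid_nonpos (fun s => dist (σ s) (τ s) -
    ((1 - s) * dist (σ 0) (τ 0) + s * dist (σ 1) (τ 1))) ?_ ?_ (by simp) (by simp) s hs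
  · linarith
  · apply ContinuousOn.sub
    · exact continuous_dist.comp_continuousOn ((key σ L hL hσ).prodMk (key τ M hM hτ))
    · fun_prop
  · intro s hs t ht
    obtain ⟨a1, a2⟩ := key2 σ L hσ s hs t ht
    obtain ⟨b1, b2⟩ := key2 τ M hτ s hs t ht
    have := quad_mid _ _ _ _ _ _ a1 a2 b1 b2
    linarith

/-- midpoint convexity -/
def MidConvex (f : X → ℝ) : Prop :=
  ∀ y z m : X, dist y m = dist y z / 2 → dist z m = dist y z / 2 → f m ≤ (f y + f z) / 2

/-- weak compactness -/
lemma weak_min [CAT0Space X] [CompleteSpace X] (f : X → ℝ) (hf : Continuous f)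
    (hm : MidConvex f) (z : X) (R : ℝ) (c : ℝ)
    (h : ∀ ε > 0, ∃ x, dist z x ≤ R ∧ f x ≤ c + ε) : ∃ x, dist z x ≤ R ∧ f x ≤ c := by
  let S : ℕ → Set X := fun n => {x | f x ≤ c + 1 / ((n:ℝ) + 1)}
  have hpos : ∀ n : ℕ, (0:ℝ) < 1 / ((n:ℝ) + 1) := fun n => by positivity
  have hanti : ∀ n m : ℕ, n ≤ m → 1 / ((m:ℝ) + 1) ≤ 1 / ((n:ℝ) + 1) := fun n m hnm =>
    one_div_le_one_div_of_le (by positivity) (by have : (n:ℝ) ≤ m := by exact_mod_cast hnm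
                                                 linarith)
  have hsub : ∀ n m : ℕ, n ≤ m → S m ⊆ S n := fun n m hnm x hx =>
    le_trans (show f x ≤ c + 1 / ((m:ℝ) + 1) from hx) (by have := hanti n m hnm; linarith)
  have hne : ∀ n, ∃ x ∈ S n, dist z x ≤ R := fun n => by
    obtain ⟨x, hx1, hx2⟩ := h _ (hpos n)
    exact ⟨x, hx2, hx1⟩
  have hR : 0 ≤ R := by
    obtain ⟨x, _, hx⟩ := hne 0
    exact dist_nonneg.trans hx
  let ρ : ℕ → ℝ := fun n => Metric.infDist z (S n)
  have hρ0 : ∀ n, 0 ≤ ρ n := fun n => infDist_nonneg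
  have hρR : ∀ n, ρ n ≤ R := fun n => by
    obtain ⟨x, hx, hx2⟩ := hne n
    exact (infDist_le_dist_of_mem hx).trans hx2
  have hρmono : Monotone ρ := fun n m hnm => by
    obtain ⟨x, hx, _⟩ := hne m
    exact infDist_le_infDist_of_subset (hsub n m hnm) ⟨x, hx⟩
  have hlim : Filter.Tendsto ρ Filter.atTop (𝓝 (⨆ n, ρ n)) :=
    tendsto_atTop_ciSup hρmono ⟨R, by rintro _ ⟨n, rfl⟩; exact hρR n⟩
  set P := ⨆ n, ρ n with hP
  have hρP : ∀ n, ρ n ≤ P := fun n => hρmono.ge_of_tendsto hlim n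
  have hPR : P ≤ R := le_of_tendsto' hlim hρR
  have hx : ∀ n, ∃ x ∈ S n, dist z x < ρ n + 1 / ((n:ℝ) + 1) := fun n => by
    obtain ⟨x, hx, _⟩ := hne n
    exact (infDist_lt_iff ⟨x, hx⟩).1 (by linarith [hpos n] : ρ n < _)
  choose x hxS hxd using hx
  have hbound : ∀ n m : ℕ, n ≤ m → dist (x n) (x m) ^ 2 ≤
      4 * ((P + 1 / ((n:ℝ) + 1)) ^ 2 - ρ n ^ 2) := by
    intro n m hnm
    obtain ⟨w, w1, w2⟩ := exists_mid (x n) (x m)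
    have hw : w ∈ S n := by
      have a := hm _ _ _ w1 w2
      have a1 : f (x n) ≤ c + 1 / ((n:ℝ) + 1) := hxS n
      have a2 : f (x m) ≤ c + 1 / ((n:ℝ) + 1) := hsub n m hnm (hxS m)
      show f w ≤ _
      linarith
    have hwd : ρ n ≤ dist z w := infDist_le_dist_of_mem hw
    have hcn := CAT0Space.cn z _ _ _ w1 w2
    have e1 : dist z (x n) ^ 2 ≤ (P + 1 / ((n:ℝ) + 1)) ^ 2 :=
      pow_le_pow_left₀ dist_nonneg (by linarith [hxd n, hρP n]) 2
    have e2 : dist z (x m) ^ 2 ≤ (P + 1 / ((n:ℝ) + 1)) ^ 2 :=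
      pow_le_pow_left₀ dist_nonneg (by linarith [hxd m, hρP m, hanti n m hnm]) 2
    have e3 : ρ n ^ 2 ≤ dist z w ^ 2 := pow_le_pow_left₀ (hρ0 n) hwd 2
    linarith
  have h1n : Filter.Tendsto (fun n : ℕ => 1 / ((n:ℝ) + 1)) Filter.atTop (𝓝 0) :=
    tendsto_one_div_add_atTop_nhds_zero_nat
  have hb0 : Filter.Tendsto (fun n : ℕ => Real.sqrt (4 * ((P + 1 / ((n:ℝ) + 1)) ^ 2 - ρ n ^ 2)))
      Filter.atTop (𝓝 0) := by
    have := ((((h1n.const_add P).pow 2).sub (hlim.pow 2)).const_mul 4).sqrt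
    simpa using this
  have hcau : CauchySeq x := by
    apply cauchySeq_of_le_tendsto_0 (fun n : ℕ => 2 * Real.sqrt (4 * ((P + 1 / ((n:ℝ) + 1)) ^ 2 - ρ n ^ 2)))
    · intro n m N hn hm'
      have a1 := Real.le_sqrt_of_sq_le (hbound N n hn)
      have a2 := Real.le_sqrt_of_sq_le (hbound N m hm')
      linarith [dist_triangle_left (x n) (x m) (x N)]
    · simpa using hb0.const_mul 2
  obtain ⟨y, hy⟩ := cauchySeq_tendsto_of_complete hcau
  refine ⟨y, ?_, ?_⟩
  · have t1 : Filter.Tendsto (fun n => dist z (x n)) Filter.atTop (𝓝 (dist z y)) :=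
      tendsto_const_nhds.dist hy
    have t2 : Filter.Tendsto (fun n : ℕ => R + 1 / ((n:ℝ) + 1)) Filter.atTop (𝓝 R) := by
      simpa using h1n.const_add R
    exact le_of_tendsto_of_tendsto' t1 t2 (fun n => by linarith [hxd n, hρR n])
  · have t1 : Filter.Tendsto (fun n => f (x n)) Filter.atTop (𝓝 (f y)) :=
      (hf.tendsto y).comp hy
    have t2 : Filter.Tendsto (fun n : ℕ => c + 1 / ((n:ℝ) + 1)) Filter.atTop (𝓝 c) := by
      simpa using h1n.const_add c
    exact le_of_tendsto_of_tendsto' t1 t2 (fun n => hxS n)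

lemma slim_aux (D : ℝ) (hD : 0 < D) (π : X → X) (A : Set X) (hc : IsContractingWith D π A)
    (x y : X) (hy : y ∈ A) (σ : ℝ → X) (l : ℝ) (hl : 0 ≤ l) (h0 : σ 0 = x) (h1 : σ l = y)
    (hσ : IsGeodesicOn σ (Icc 0 l)) : ∃ s ∈ Icc 0 l, dist (π x) (σ s) ≤ 16 * D := by
  obtain ⟨hp, hcon⟩ := hc
  have hcd : ∀ p, dist p (π p) = infDist p A := fun p => by
    apply le_antisymm
    · exact (le_infDist ⟨y, hy⟩).2 (fun a ha => (hp p).2 a ha)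
    · exact infDist_le_dist_of_mem (hp p).1
  have hcont : ContinuousOn (fun s => dist (σ s) (π (σ s))) (Icc 0 l) := by
    simp_rw [hcd]
    have : ContinuousOn σ (Icc 0 l) := by
      have : LipschitzOnWith 1 σ (Icc 0 l) := by
        apply LipschitzOnWith.of_dist_le_mul
        intro a ha b hb
        rw [hσ ha hb, Real.dist_eq]; simp
      exact this.continuousOn
    exact (continuous_infDist_pt A).comp_continuousOn this
  have hS : IsCompact (Icc (0:ℝ) l ∩ (fun s => dist (σ s) (π (σ s))) ⁻¹' (Iic (4 * D))) :=
    isCompact_Icc.of_isClosed_subset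
      (hcont.preimage_isClosed_of_isClosed isClosed_Icc isClosed_Iic) inter_subset_left
  have hlmem : l ∈ Icc (0:ℝ) l ∩ (fun s => dist (σ s) (π (σ s))) ⁻¹' (Iic (4 * D)) := by
    refine ⟨⟨hl, le_refl _⟩, ?_⟩
    show dist (σ l) (π (σ l)) ≤ 4 * D
    rw [h1]
    have := (hp y).2 y hy
    rw [dist_self] at this
    linarith
  obtain ⟨s1, ⟨hs1, hs1f⟩, hleast⟩ := hS.exists_isLeast ⟨l, hlmem⟩
  have hs1f' : dist (σ s1) (π (σ s1)) ≤ 4 * D := hs1f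
  have hbig : ∀ u, 0 ≤ u → u < s1 → 4 * D < dist (σ u) (π (σ u)) := by
    intro u hu hus
    by_contra! hcon2
    have := hleast ⟨⟨hu, hus.le.trans hs1.2⟩, hcon2⟩
    linarith
  have h0mem : (0:ℝ) ∈ Icc 0 l := ⟨le_refl _, hl⟩
  by_cases hh : dist x (π x) ≤ 4 * D
  · refine ⟨0, h0mem, ?_⟩
    rw [h0, dist_comm]; linarith
  push Not at hh
  set h := dist x (π x) with hh'
  have disp : ∀ n : ℕ, ∀ s, 0 ≤ s → s ≤ s1 → s1 ≤ s + n * (2 * D) →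
      dist (π (σ s)) (π (σ s1)) ≤ n * D := by
    intro n
    induction n with
    | zero =>
      intro s hs hss hs2
      have : s = s1 := by apply le_antisymm hss; simpa using hs2
      simp [this]
    | succ k ih =>
      intro s hs hss hs2
      push_cast at hs2 ⊢
      rcases eq_or_lt_of_le hss with he | hlt
      · rw [he, dist_self]; positivity
      have hb := hbig s hs hlt
      have hmin1 : s < min s1 (s + 2 * D) := lt_min hlt (by linarith)
      have hmin2 : min s1 (s + 2 * D) ≤ s1 := min_le_left _ _
      have hmin3 : min s1 (s + 2 * D) ≤ s + 2 * D := min_le_right _ _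
      have hmin4 : s1 ≤ min s1 (s + 2 * D) + k * (2 * D) := by
        rcases min_choice s1 (s + 2 * D) with h | h <;> rw [h]
        · have : 0 ≤ (k:ℝ) * (2 * D) := by positivity
          linarith
        · linarith
      set t := min s1 (s + 2 * D)
      have e1 := ih t (by linarith) hmin2 hmin4
      have e2 : dist (π (σ s)) (π (σ t)) < D := by
        apply hcon
        rw [hσ ⟨hs, by linarith [hs1.2]⟩ ⟨by linarith, by linarith [hs1.2]⟩, abs_sub_comm,
          abs_of_nonneg (by linarith)]
        linarith
      linarith [dist_triangle (π (σ s)) (π (σ t)) (π (σ s1))]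
  have hs1d : dist x (σ s1) = s1 := by
    rw [← h0, hσ h0mem hs1, zero_sub, abs_neg, abs_of_nonneg hs1.1]
  have hs1h : h - 4 * D ≤ s1 := by
    have := (hp x).2 _ (hp (σ s1)).1
    linarith [dist_triangle x (σ s1) (π (σ s1))]
  have e1 : dist (π x) (π (σ (h - 4 * D))) < D := by
    apply hcon
    rw [← h0, hσ h0mem ⟨by linarith, by linarith [hs1.2]⟩, zero_sub, abs_neg,
      abs_of_nonneg (by linarith), h0]
    linarith
  have hn := Nat.le_ceil ((s1 - (h - 4 * D)) / (2 * D))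
  have hn2 := Nat.ceil_lt_add_one (a := (s1 - (h - 4 * D)) / (2 * D))
    (div_nonneg (by linarith) (by linarith))
  set n := ⌈(s1 - (h - 4 * D)) / (2 * D)⌉₊
  have hn' : s1 - (h - 4 * D) ≤ n * (2 * D) := (div_le_iff₀ (by linarith)).1 hn
  have hn2' : (n - 1 : ℝ) * (2 * D) < s1 - (h - 4 * D) :=
    (lt_div_iff₀ (by linarith)).1 (by linarith)
  have e2 := disp n (h - 4 * D) (by linarith) hs1h (by linarith)
  have e3 := dist_triangle (π x) (π (σ (h - 4 * D))) (π (σ s1))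
  have e4 := dist_triangle x (π x) (σ s1)
  have e5 := dist_triangle (π x) (π (σ s1)) (σ s1)
  rw [dist_comm (π (σ s1)) (σ s1)] at e5
  refine ⟨s1, hs1, ?_⟩
  nlinarith

/-- `b` is the Busemann function of `α`. -/
def IsBuse (α : ℝ → X) (b : X → ℝ) : Prop :=
  (∀ x, Filter.Tendsto (fun n : ℕ => dist x (α n) - n) Filter.atTop (𝓝 (b x))) ∧
  ∀ x, ∀ n : ℕ, b x ≤ dist x (α n) - n

lemma exists_buse (α : ℝ → X) (hα : IsGeodesicOn α (Ici 0)) : ∃ b, IsBuse α b := by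
  have hanti : ∀ x, Antitone (fun n : ℕ => dist x (α n) - n) := by
    intro x n m hnm
    have hnm' : (n:ℝ) ≤ m := by exact_mod_cast hnm
    have := hα (show (n:ℝ) ∈ Ici 0 from mem_Ici.2 (Nat.cast_nonneg n)) (show (m:ℝ) ∈ Ici 0 from mem_Ici.2 (Nat.cast_nonneg m))
    rw [abs_sub_comm, abs_of_nonneg (by linarith)] at this
    have := dist_triangle x (α n) (α m)
    show dist x (α m) - m ≤ dist x (α n) - n
    linarith
  have hT : ∀ x, Filter.Tendsto (fun n : ℕ => dist x (α n) - n) Filter.atTop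
      (𝓝 (⨅ n : ℕ, (dist x (α n) - n))) := by
    intro x
    apply tendsto_atTop_ciInf (hanti x)
    refine ⟨- dist x (α 0), ?_⟩
    rintro _ ⟨n, rfl⟩
    have := hα (show (0:ℝ) ∈ Ici 0 from le_refl (0:ℝ)) (show (n:ℝ) ∈ Ici 0 from mem_Ici.2 (Nat.cast_nonneg n))
    rw [zero_sub, abs_neg, abs_of_nonneg (Nat.cast_nonneg n)] at this
    have := dist_triangle_left (α 0) (α n) x
    show - dist x (α 0) ≤ dist x (α n) - n
    linarith
  exact ⟨_, hT, fun x n => (hanti x).le_of_tendsto (hT x) n⟩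

lemma IsBuse.lip {α : ℝ → X} {b : X → ℝ} (h : IsBuse α b) (x y : X) : b x ≤ b y + dist x y := by
  refine le_of_tendsto_of_tendsto' (h.1 x) ((h.1 y).add_const (dist x y)) (fun n => ?_)
  linarith [dist_triangle x y (α n)]

lemma IsBuse.cont {α : ℝ → X} {b : X → ℝ} (h : IsBuse α b) : Continuous b := by
  have : LipschitzWith 1 b := LipschitzWith.of_le_add (fun x y => h.lip x y)
  exact this.continuous

lemma IsBuse.mid [CAT0Space X] {α : ℝ → X} {b : X → ℝ} (h : IsBuse α b) : MidConvex b := by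
  intro y z m h1 h2
  refine le_of_tendsto_of_tendsto' (h.1 m) (((h.1 y).add (h.1 z)).div_const 2) (fun n => ?_)
  have := cn_mid_dist (α n) y z m h1 h2
  rw [dist_comm m, dist_comm y, dist_comm z]
  linarith

lemma midConvex_dist [CAT0Space X] (p : X) : MidConvex (fun x => dist x p) := by
  intro y z m h1 h2
  have := cn_mid_dist p y z m h1 h2
  simp only
  rw [dist_comm m, dist_comm y, dist_comm z]
  exact this

lemma MidConvex.max {f g : X → ℝ} (hf : MidConvex f) (hg : MidConvex g) :
    MidConvex (fun x => Max.max (f x) (g x)) := by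
  intro y z m h1 h2
  have a := hf y z m h1 h2
  have b := hg y z m h1 h2
  have := le_max_left (f y) (g y)
  have := le_max_right (f y) (g y)
  have := le_max_left (f z) (g z)
  have := le_max_right (f z) (g z)
  exact max_le (by linarith) (by linarith)

lemma MidConvex.addc {f : X → ℝ} (hf : MidConvex f) (c : ℝ) :
    MidConvex (fun x => f x - c) := by
  intro y z m h1 h2
  have a := hf y z m h1 h2
  simp only
  linarith

lemma MidConvex.add {f g : X → ℝ} (hf : MidConvex f) (hg : MidConvex g) :
    MidConvex (fun x => f x + g x) := by
  intro y z m h1 h2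
  have a := hf y z m h1 h2
  have b := hg y z m h1 h2
  simp only
  linarith

/-- fellow travelling -/
lemma fellow [CAT0Space X] (α : ℝ → X) (hα : IsGeodesicOn α (Ici 0)) (z : X) (n : ℕ)
    (s : ℝ) (hs : 0 ≤ s) (hsl : s < dist z (α n)) :
    ∃ y, dist z y = s ∧ dist y (α n) = dist z (α n) - s ∧ dist y (α s) ≤ 2 * dist z (α 0) := by
  obtain ⟨σ, h0, h1, hg⟩ := GeodesicSpace.geodesic z (α n)
  set l := dist z (α n) with hl
  have hl0 : 0 < l := by linarith
  have hn0 : (0:ℝ) ≤ n := Nat.cast_nonneg n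
  have hz : (0:ℝ) ∈ Icc 0 l := ⟨le_refl _, hl0.le⟩
  have hll : l ∈ Icc 0 l := ⟨hl0.le, le_refl _⟩
  have hsm : s ∈ Icc 0 l := ⟨hs, hsl.le⟩
  refine ⟨σ s, ?_, ?_, ?_⟩
  · rw [← h0, hg hz hsm, zero_sub, abs_neg, abs_of_nonneg hs]
  · rw [← h1, hg hsm hll, abs_sub_comm, abs_of_nonneg (by linarith)]
  have hq0 : 0 ≤ s / l := by positivity
  have hq1 : s / l ≤ 1 := (div_le_one hl0).2 hsl.le
  have key := conv_dist (fun u => σ (u * l)) (fun u => α (u * n)) l n hl0.le hn0 ?_ ?_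
    (s / l) ⟨hq0, hq1⟩
  · simp only [zero_mul, one_mul, h0, h1, dist_self, mul_zero, add_zero] at key
    rw [div_mul_cancel₀ _ hl0.ne'] at key
    have hd : dist (α (s / l * n)) (α s) ≤ dist z (α 0) := by
      rw [hα (show s / l * n ∈ Ici 0 from mul_nonneg hq0 hn0) (show s ∈ Ici 0 from hs)]
      have e : s / l * n - s = s / l * (n - l) := by field_simp
      rw [e, abs_mul, abs_of_nonneg hq0]
      have hnl : |(n:ℝ) - l| ≤ dist z (α 0) := by
        have a := hα (show (0:ℝ) ∈ Ici 0 from le_refl (0:ℝ)) (show (n:ℝ) ∈ Ici 0 from hn0)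
        rw [zero_sub, abs_neg, abs_of_nonneg hn0] at a
        rw [abs_le]
        constructor
        · linarith [dist_triangle z (α 0) (α n)]
        · linarith [dist_triangle_left (α 0) (α n) z]
      calc _ ≤ 1 * |(n:ℝ) - l| := by gcongr
        _ ≤ _ := by linarith
    have hk : (1 - s / l) * dist z (α 0) ≤ dist z (α 0) := by
      nlinarith [dist_nonneg (x := z) (y := α 0)]
    linarith [dist_triangle (σ s) (α (s / l * n)) (α s)]
  · intro a ha b hb
    rw [hg ⟨by nlinarith [ha.1], by nlinarith [ha.2]⟩ ⟨by nlinarith [hb.1], by nlinarith [hb.2]⟩,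
      ← sub_mul, abs_mul, abs_of_nonneg hl0.le]
  · intro a ha b hb
    rw [hα (show a * n ∈ Ici 0 from mul_nonneg ha.1 hn0)
      (show b * n ∈ Ici 0 from mul_nonneg hb.1 hn0), ← sub_mul, abs_mul, abs_of_nonneg hn0]

lemma ray_point [CAT0Space X] [CompleteSpace X] (α : ℝ → X) (hα : IsGeodesicOn α (Ici 0))
    (b : X → ℝ) (hb : IsBuse α b) (z : X) (s : ℝ) (hs : 0 ≤ s) :
    ∃ x, dist z x ≤ s ∧ b x ≤ b z - s ∧ dist x (α s) ≤ 2 * dist z (α 0) := by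
  have := weak_min (fun x => max (b x - (b z - s)) (dist x (α s) - 2 * dist z (α 0))) ?_ ?_ z s 0 ?_
  · obtain ⟨x, h1, h2⟩ := this
    have a1 := (le_max_left _ _).trans h2
    have a2 := (le_max_right _ _).trans h2
    exact ⟨x, h1, by linarith, by linarith⟩
  · exact (hb.cont.sub continuous_const).max
      ((continuous_id.dist continuous_const).sub continuous_const)
  · exact (hb.mid.addc _).max ((midConvex_dist _).addc _)
  · intro ε hε
    have h1 : ∀ᶠ n : ℕ in Filter.atTop, dist z (α n) - n < b z + ε :=
      (hb.1 z).eventually_lt_const (by linarith)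
    have h2 : ∀ᶠ n : ℕ in Filter.atTop, s - b z < n :=
      tendsto_natCast_atTop_atTop.eventually_gt_atTop _
    obtain ⟨n, h1, h2⟩ := (h1.and h2).exists
    have h3 := hb.2 z n
    obtain ⟨y, y1, y2, y3⟩ := fellow α hα z n s hs (by linarith)
    refine ⟨y, y1.le, ?_⟩
    have := hb.2 y n
    exact max_le (by linarith) (by linarith)

lemma ray_unique_s14 [CAT0Space X] (α : ℝ → X) 
    (b : X → ℝ) (hb : IsBuse α b) (z : X) (s : ℝ) (x y : X)
    (hx : dist z x ≤ s) (hx' : b x ≤ b z - s) (hy : dist z y ≤ s) (hy' : b y ≤ b z - s) :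
    x = y := by
  obtain ⟨m, m1, m2⟩ := exists_mid x y
  have h1 := hb.mid x y m m1 m2
  have h2 := hb.lip z m
  have h3 : s ≤ dist z m := by linarith
  have hcn := CAT0Space.cn z x y m m1 m2
  have hs : 0 ≤ s := dist_nonneg.trans hx
  have e1 := pow_le_pow_left₀ dist_nonneg hx 2
  have e2 := pow_le_pow_left₀ dist_nonneg hy 2
  have e3 := pow_le_pow_left₀ hs h3 2
  have : dist x y ^ 2 ≤ 0 := by linarith
  have : dist x y = 0 := by
    have := le_antisymm this (sq_nonneg _)
    exact pow_eq_zero_iff (two_ne_zero) |>.1 this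
  exact dist_eq_zero.1 this

lemma exists_ray [CAT0Space X] [CompleteSpace X] (α : ℝ → X) (hα : IsGeodesicOn α (Ici 0))
    (b : X → ℝ) (hb : IsBuse α b) (z : X) :
    ∃ r : ℝ → X, r 0 = z ∧ IsGeodesicOn r (Ici 0) ∧ 
      ∀ s, 0 ≤ s → b (r s) ≤ b z - s ∧ dist (r s) (α s) ≤ 2 * dist z (α 0) := by
  have h : ∀ s, ∃ x, 0 ≤ s → dist z x ≤ s ∧ b x ≤ b z - s ∧ dist x (α s) ≤ 2 * dist z (α 0) := by
    intro s
    by_cases hs : 0 ≤ s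
    · obtain ⟨x, hx⟩ := ray_point α hα b hb z s hs
      exact ⟨x, fun _ => hx⟩
    · exact ⟨z, fun h => absurd h hs⟩
  choose r hr using h
  have hle : ∀ s t, 0 ≤ s → s ≤ t → dist (r s) (r t) = t - s := by
    intro s t hs hst
    obtain ⟨a1, a2, a3⟩ := hr s hs
    obtain ⟨b1, b2, b3⟩ := hr t (hs.trans hst)
    obtain ⟨x, x1, x2, _⟩ := ray_point α hα b hb (r s) (t - s) (by linarith)
    have hx : x = r t := ray_unique_s14 α b hb z t x (r t)
      (by linarith [dist_triangle z (r s) x]) (by linarith) b1 b2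
    rw [hx] at x1
    apply le_antisymm x1
    have := hb.lip (r s) (r t)
    have := hb.lip z (r s)
    linarith
  refine ⟨r, ?_, ?_, fun s hs => (hr s hs).2⟩
  · exact (dist_le_zero.1 (hr 0 le_rfl).1).symm
  · intro s hs t ht
    rcases le_total s t with h | h
    · rw [hle s t hs h, abs_sub_comm, abs_of_nonneg (by linarith)]
    · rw [dist_comm, hle t s ht h, abs_of_nonneg (by linarith)]

lemma diverge [CAT0Space X] (α β : ℝ → X) (h0 : α 0 = β 0)
    (hα : IsGeodesicOn α (Ici 0)) (hβ : IsGeodesicOn β (Ici 0)) (t u : ℝ) (ht : 0 < t)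
    (htu : t ≤ u) : u * dist (α t) (β t) ≤ t * dist (α u) (β u) := by
  have hu : 0 < u := by linarith
  have key := conv_dist (fun v => α (v * u)) (fun v => β (v * u)) u u hu.le hu.le ?_ ?_
    (t / u) ⟨by positivity, (div_le_one hu).2 htu⟩
  · simp only [zero_mul, one_mul, h0, dist_self, mul_zero, zero_add] at key
    rw [div_mul_cancel₀ _ hu.ne', div_mul_eq_mul_div, le_div_iff₀ hu] at key
    linarith
  · intro a ha b hb
    rw [hα (show a * u ∈ Ici 0 from mul_nonneg ha.1 hu.le)
      (show b * u ∈ Ici 0 from mul_nonneg hb.1 hu.le), ← sub_mul, abs_mul, abs_of_nonneg hu.le]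
  · intro a ha b hb
    rw [hβ (show a * u ∈ Ici 0 from mul_nonneg ha.1 hu.le)
      (show b * u ∈ Ici 0 from mul_nonneg hb.1 hu.le), ← sub_mul, abs_mul, abs_of_nonneg hu.le]

lemma bounded_proj [CAT0Space X] (α β : ℝ → X) (h0 : α 0 = β 0)
    (hα : IsGeodesicOn α (Ici 0)) (hβ : IsGeodesicOn β (Ici 0))
    (hne : ∃ t ≥ (0:ℝ), α t ≠ β t) (D : ℝ) (hD : 0 < D)
    (π : X → X) (hc : IsContractingWith D π (α '' Ici 0)) :
    ∃ B : ℝ, ∀ t ≥ (0:ℝ), dist (α 0) (π (β t)) ≤ B := by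
  obtain ⟨t0, ht0, hne⟩ := hne
  have ht0' : 0 < t0 := lt_of_le_of_ne ht0 (by rintro rfl; exact hne h0)
  have hd0 : 0 < dist (α t0) (β t0) := dist_pos.2 hne
  set d := dist (α t0) (β t0)
  refine ⟨t0 + 2 * (16 * D) * t0 / d + 16 * D, fun t ht => ?_⟩
  obtain ⟨s, hs, hsd⟩ := slim_aux D hD π _ hc (β t) (α 0) ⟨0, le_refl (0:ℝ), rfl⟩
    (fun s => β (t - s)) t ht (by simp) (by simp [h0]) (by
      intro a ha b hb
      show dist (β (t - a)) (β (t - b)) = _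
      rw [hβ (show t - a ∈ Ici 0 from sub_nonneg.2 ha.2) (show t - b ∈ Ici 0 from sub_nonneg.2 hb.2),
        abs_sub_comm]
      congr 1; ring)
  have hu0 : 0 ≤ t - s := sub_nonneg.2 hs.2
  set u := t - s
  obtain ⟨v, hv, hve⟩ := (hc.1 (β t)).1
  rw [← hve] at hsd ⊢
  have hub : u ≤ t0 + 2 * (16 * D) * t0 / d := by
    have hpos : 0 ≤ 2 * (16 * D) * t0 / d := by positivity
    rcases le_total u t0 with h | h
    · linarith
    · have k1 := diverge α β h0 hα hβ t0 u ht0' h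
      have k2 : dist (α u) (β u) ≤ 2 * (16 * D) := by
        have a1 := hα (show u ∈ Ici 0 from hu0) hv
        have a2 := hα (show (0:ℝ) ∈ Ici 0 from le_refl (0:ℝ)) hv
        have a3 := hβ (show (0:ℝ) ∈ Ici 0 from le_refl (0:ℝ)) (show u ∈ Ici 0 from hu0)
        rw [zero_sub, abs_neg, abs_of_nonneg hv] at a2
        rw [zero_sub, abs_neg, abs_of_nonneg hu0, ← h0] at a3
        have a4 : |u - v| ≤ dist (α v) (β u) := by
          rw [abs_le]
          constructor
          · linarith [dist_triangle_right (α 0) (α v) (β u)]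
          · linarith [dist_triangle (α 0) (α v) (β u)]
        linarith [dist_triangle (α u) (α v) (β u)]
      have : u ≤ 2 * (16 * D) * t0 / d := by
        rw [le_div_iff₀ hd0]
        nlinarith
      linarith
  have a3 := hβ (show (0:ℝ) ∈ Ici 0 from le_refl (0:ℝ)) (show u ∈ Ici 0 from hu0)
  rw [zero_sub, abs_neg, abs_of_nonneg hu0, ← h0] at a3
  linarith [dist_triangle_right (α 0) (α v) (β u)]

lemma exists_line [CAT0Space X] [CompleteSpace X] (α β : ℝ → X) (h0 : α 0 = β 0)
    (hα : IsGeodesicOn α (Ici 0)) (hβ : IsGeodesicOn β (Ici 0)) (D : ℝ) (hD : 0 < D)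
    (π : X → X) (hc : IsContractingWith D π (α '' Ici 0)) (B : ℝ)
    (hB : ∀ t ≥ (0:ℝ), dist (α 0) (π (β t)) ≤ B) :
    ∃ γ : ℝ → X, IsGeodesicOn γ Set.univ ∧
      (∃ K : ℝ, HausdorffLE (γ '' Set.Ici 0) (α '' Set.Ici 0) K) ∧
      (∃ K : ℝ, HausdorffLE (γ '' Set.Iic 0) (β '' Set.Ici 0) K) := by
  obtain ⟨a, ha⟩ := exists_buse α hα
  obtain ⟨b, hb⟩ := exists_buse β hβ
  set K := B + 16 * D
  -- points near `α 0` on the geodesics from `β n` to `α n`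
  have hq : ∀ n : ℕ, ∃ q, dist (α 0) q ≤ K ∧
      dist q (α n) + dist q (β n) = dist (α n) (β n) := by
    intro n
    have hn0 : (0:ℝ) ≤ n := Nat.cast_nonneg n
    obtain ⟨σ, g0, g1, hg⟩ := GeodesicSpace.geodesic (β n) (α n)
    obtain ⟨s, hs, hsd⟩ := slim_aux D hD π _ hc (β n) (α n) ⟨n, hn0, rfl⟩ σ _ dist_nonneg g0 g1 hg
    refine ⟨σ s, ?_, ?_⟩
    · have := hB n hn0
      have := dist_triangle (α 0) (π (β n)) (σ s)
      show _ ≤ B + 16 * D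
      linarith
    · have e1 := hg (show (0:ℝ) ∈ Icc 0 (dist (β n) (α n)) from ⟨le_refl _, dist_nonneg⟩) hs
      have e2 := hg hs (show dist (β n) (α n) ∈ Icc 0 (dist (β n) (α n)) from
        ⟨dist_nonneg, le_refl _⟩)
      rw [g0, zero_sub, abs_neg, abs_of_nonneg hs.1] at e1
      rw [g1, abs_sub_comm, abs_of_nonneg (by linarith [hs.2])] at e2
      rw [e2, dist_comm (σ s), e1, dist_comm (α n)]
      ring
  choose q hq1 hq2 using hq
  have hlow : ∀ x, ∃ c : ℝ, -(2 * K) ≤ a x + b x := by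
    intro x; exact ⟨0, by
      have t := (ha.1 x).add (hb.1 x)
      refine ge_of_tendsto' t (fun n => ?_)
      have hn0 : (0:ℝ) ≤ n := Nat.cast_nonneg n
      have e1 := hα (show (0:ℝ) ∈ Ici 0 from le_refl (0:ℝ)) (show (n:ℝ) ∈ Ici 0 from hn0)
      have e2 := hβ (show (0:ℝ) ∈ Ici 0 from le_refl (0:ℝ)) (show (n:ℝ) ∈ Ici 0 from hn0)
      rw [zero_sub, abs_neg, abs_of_nonneg hn0] at e1 e2
      rw [← h0] at e2
      have := dist_triangle (α 0) (q n) (α n)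
      have := dist_triangle (α 0) (q n) (β n)
      have := dist_triangle_left (α n) (β n) x
      linarith [hq1 n, hq2 n]⟩
  have hlow' : ∀ x, -(2 * K) ≤ a x + b x := fun x => (hlow x).choose_spec
  have : Nonempty X := ⟨α 0⟩
  have hbdd : BddBelow (range (fun x => a x + b x)) := ⟨-(2 * K), by
    rintro _ ⟨x, rfl⟩; exact hlow' x⟩
  set c := ⨅ x, (a x + b x) with hcdef
  have hcle : ∀ x, c ≤ a x + b x := fun x => ciInf_le hbdd x
  obtain ⟨z, hz1, hz2⟩ := weak_min (fun x => a x + b x) (ha.cont.add hb.cont)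
    (ha.mid.add hb.mid) (α 0) K c (by
      intro ε hε
      obtain ⟨x, hx⟩ := exists_lt_of_ciInf_lt (show (⨅ x, (a x + b x)) < c + ε by linarith)
      have t := (ha.1 x).add (hb.1 x)
      obtain ⟨n, hn⟩ := (t.eventually_lt_const hx).exists
      refine ⟨q n, hq1 n, ?_⟩
      have := ha.2 (q n) n
      have := hb.2 (q n) n
      have := dist_triangle_left (α n) (β n) x
      linarith [hq2 n])
  obtain ⟨r, r0, rg, hr⟩ := exists_ray α hα a ha z
  obtain ⟨p, p0, pg, hp⟩ := exists_ray β hβ b hb z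
  have hrp : ∀ s u, 0 ≤ s → 0 ≤ u → dist (r s) (p u) = s + u := by
    intro s u hs hu
    apply le_antisymm
    · have e1 := rg (show s ∈ Ici 0 from hs) (show (0:ℝ) ∈ Ici 0 from le_refl (0:ℝ))
      have e2 := pg (show (0:ℝ) ∈ Ici 0 from le_refl (0:ℝ)) (show u ∈ Ici 0 from hu)
      rw [sub_zero, abs_of_nonneg hs, r0] at e1
      rw [zero_sub, abs_neg, abs_of_nonneg hu, p0] at e2
      linarith [dist_triangle (r s) z (p u)]
    · have := hcle (r s)
      have := (hr s hs).1
      have := (hp u hu).1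
      have := hb.lip (r s) (p u)
      linarith
  let γ : ℝ → X := fun s => if 0 ≤ s then r s else p (-s)
  have γ1 : ∀ s, 0 ≤ s → γ s = r s := fun s hs => if_pos hs
  have γ2 : ∀ s, s ≤ 0 → γ s = p (-s) := fun s hs => by
    rcases eq_or_lt_of_le hs with h | h
    · rw [h, γ1 0 le_rfl, neg_zero, r0, p0]
    · exact if_neg (not_le.2 h)
  refine ⟨γ, ?_, ⟨2 * dist z (α 0), ?_, ?_⟩, ⟨2 * dist z (β 0), ?_, ?_⟩⟩
  · intro s _ t _
    rcases le_total 0 s with hs | hs <;> rcases le_total 0 t with ht | ht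
    · rw [γ1 s hs, γ1 t ht]; exact rg hs ht
    · rw [γ1 s hs, γ2 t ht, hrp s (-t) hs (by linarith), abs_of_nonneg (by linarith)]; ring
    · rw [γ2 s hs, γ1 t ht, dist_comm, hrp t (-s) ht (by linarith), abs_of_nonpos (by linarith)]
      ring
    · rw [γ2 s hs, γ2 t ht, pg (show -s ∈ Ici 0 from neg_nonneg.2 hs)
        (show -t ∈ Ici 0 from neg_nonneg.2 ht), abs_sub_comm]
      congr 1; ring
  · rintro _ ⟨s, hs, rfl⟩
    exact ⟨α s, ⟨s, hs, rfl⟩, by rw [γ1 s hs]; exact (hr s hs).2⟩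
  · rintro _ ⟨s, hs, rfl⟩
    exact ⟨γ s, ⟨s, hs, rfl⟩, by rw [γ1 s hs]; exact (hr s hs).2⟩
  · rintro _ ⟨s, hs, rfl⟩
    have hs' : 0 ≤ -s := neg_nonneg.2 hs
    exact ⟨β (-s), ⟨-s, hs', rfl⟩, by rw [γ2 s hs]; exact (hp (-s) hs').2⟩
  · rintro _ ⟨s, hs, rfl⟩
    have hs' : -s ≤ 0 := neg_nonpos.2 hs
    exact ⟨γ (-s), ⟨-s, hs', rfl⟩, by rw [γ2 (-s) hs', neg_neg]; exact (hp s hs).2⟩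

end helpers

/-- if `α` and `β` are distinct rays from `x₀` and `α` is contracting, then
the projection of `β` onto `α` is bounded, and there is a bi-infinite geodesic `γ` with
`γ(∞) = α(∞)` and `γ(-∞) = β(∞)`. -/
theorem stmt14 {X : Type*} [MetricSpace X] [CAT0Space X] [CompleteSpace X]
    (x₀ : X) (α β : ℝ → X) (hα0 : α 0 = x₀) (hβ0 : β 0 = x₀)
    (hα : IsGeodesicOn α (Set.Ici 0)) (hβ : IsGeodesicOn β (Set.Ici 0))
    (hne : ∃ t ≥ (0:ℝ), α t ≠ β t)
    (D : ℝ) (π : X → X) (hc : IsContractingWith D π (α '' Set.Ici 0)) :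
    (∃ B : ℝ, ∀ t ≥ (0:ℝ), dist x₀ (π (β t)) ≤ B) ∧
    ∃ γ : ℝ → X, IsGeodesicOn γ Set.univ ∧
      (∃ K : ℝ, HausdorffLE (γ '' Set.Ici 0) (α '' Set.Ici 0) K) ∧
      (∃ K : ℝ, HausdorffLE (γ '' Set.Iic 0) (β '' Set.Ici 0) K) := by
  have h0 : α 0 = β 0 := hα0.trans hβ0.symm
  have hc' : IsContractingWith (max D 1) π (α '' Set.Ici 0) :=
    ⟨hc.1, fun x y h => (hc.2 x y h).trans_le (le_max_left _ _)⟩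
  have hD : 0 < max D 1 := lt_of_lt_of_le one_pos (le_max_right _ _)
  obtain ⟨B, hB⟩ := bounded_proj α β h0 hα hβ hne _ hD π hc'
  refine ⟨⟨B, ?_⟩, exists_line α β h0 hα hβ _ hD π hc' B hB⟩
  rw [← hα0]
  exact hB
end
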